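/- arXiv:math/0402377 — 2 statements merged into one kernel-verified Lean document; each statement's English description precedes it below -/
import Mathlib

section
/- Let (W,S) be a Coxeter system with S finite and W infinite. Then W is virtually abelian if and only if for every real number x with 0 < x < 1 the family (x^{ℓ(w)})_{w∈W} is summable; equivalently, the radius of convergence of the growth series Σ_{w∈W} t^{ℓ(w)} equals 1. -/
namespace CoxeterMatrix

/-- The simple roots, as the standard basis vectors. -/
def simpleRoot {B : Type*} [DecidableEq B] (i : B) : B → ℝ := Pi.single i 1

theorem simpleRoot_nonneg {B : Type*} [DecidableEq B] (i : B) : 0 ≤ simpleRoot i := by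
  simp [simpleRoot]

variable {B : Type*} [Fintype B] [DecidableEq B] (M : CoxeterMatrix B)

/-- The Tits form of a Coxeter matrix: `B(αᵢ, αⱼ) = -cos (π / mᵢⱼ)`, which is `-1` for
`mᵢⱼ = ∞` (encoded as `0`). -/
noncomputable def titsForm : LinearMap.BilinForm ℝ (B → ℝ) :=
  Matrix.toBilin' (Matrix.of fun i j => -Real.cos (Real.pi / M i j))

theorem titsForm_simpleRoot (i j : B) :
    M.titsForm (simpleRoot i) (simpleRoot j) = -Real.cos (Real.pi / M i j) := by
  simp [titsForm, simpleRoot]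

theorem titsForm_simpleRoot_self (i : B) : M.titsForm (simpleRoot i) (simpleRoot i) = 1 := by
  simp [titsForm_simpleRoot]

theorem titsForm_comm (v w : B → ℝ) : M.titsForm v w = M.titsForm w v := by
  have h : M.titsForm = M.titsForm.flip := by
    apply LinearMap.BilinForm.ext_basis (Pi.basisFun ℝ B)
    intro i j
    have := M.titsForm_simpleRoot i j
    have h2 := M.titsForm_simpleRoot j i
    simp only [simpleRoot] at this h2
    simp [this, h2, M.symmetric i j]
  conv_lhs => rw [h]
  rfl

/-- The simple reflection `v ↦ v - 2 B(αᵢ, v) αᵢ`. -/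
noncomputable def simpleReflection (i : B) : (B → ℝ) ≃ₗ[ℝ] (B → ℝ) :=
  Module.reflection (x := simpleRoot i) (f := (2 : ℝ) • M.titsForm (simpleRoot i))
    (by simp [titsForm_simpleRoot_self])

theorem simpleReflection_apply (i : B) (v : B → ℝ) :
    M.simpleReflection i v = v - (2 * M.titsForm (simpleRoot i) v) • simpleRoot i := by
  simp [simpleReflection, Module.reflection_apply]

theorem isLiftable_simpleReflection : M.IsLiftable M.simpleReflection := by
  intro i j
  by_cases hij : i = j
  · subst hij
    ext1 v
    simp [simpleReflection_apply, titsForm_simpleRoot_self]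
    module
  by_cases h0 : M i j = 0
  · simp [h0]
  have h1 : M i j ≠ 1 := M.off_diagonal i j hij
  have hji : M j i = M i j := M.symmetric j i
  ext1 v
  by_cases h2 : M i j = 2
  · have hc : M.titsForm (simpleRoot i) (simpleRoot j) = 0 := by
      simp [titsForm_simpleRoot, h2]
    have hc' : M.titsForm (simpleRoot j) (simpleRoot i) = 0 := by
      simp [titsForm_simpleRoot, h2, hji]
    simp [h2, pow_two, simpleReflection_apply, hc, hc', titsForm_simpleRoot_self]
    module
  have h3 : 3 ≤ M i j := by omega
  set m := M i j with hm
  have hmpos : (0 : ℝ) < m := by positivity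
  set θ : ℝ := 2 * Real.pi / m with hθ
  have hsin : Real.sin θ ≠ 0 := by
    apply ne_of_gt
    apply Real.sin_pos_of_pos_of_lt_pi
    · positivity
    · rw [hθ, div_lt_iff₀ hmpos]
      have : (3 : ℝ) ≤ m := by exact_mod_cast h3
      nlinarith [Real.pi_pos]
  have key := Module.reflection_mul_reflection_pow_apply
    (f := (2 : ℝ) • M.titsForm (simpleRoot i)) (g := (2 : ℝ) • M.titsForm (simpleRoot j))
    (x := simpleRoot i) (y := simpleRoot j)
    (by simp [titsForm_simpleRoot_self]) (by simp [titsForm_simpleRoot_self]) m v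
    (2 * Real.cos θ) (by
      simp only [LinearMap.smul_apply, titsForm_simpleRoot, hji, smul_eq_mul, ← hm]
      have : θ = 2 * (Real.pi / m) := by rw [hθ]; ring
      rw [this, Real.cos_two_mul]; ring)
  change ((M.simpleReflection i * M.simpleReflection j) ^ m) v = v
  refine key.trans ?_
  have hS (k : ℤ) : ((Polynomial.Chebyshev.S ℝ k).eval (2 * Real.cos θ)) =
      Real.sin ((k + 1) * θ) / Real.sin θ := by
    rw [eq_div_iff hsin, Polynomial.Chebyshev.S_two_mul_real_cos]
  have hmθ : (m : ℝ) * θ = 2 * Real.pi := by rw [hθ]; field_simp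
  obtain ⟨k, hk⟩ | ⟨k, hk⟩ := Nat.even_or_odd m
  · have e1 : ((m : ℤ) - 2) / 2 = k - 1 := by omega
    have e2 : ((m : ℤ) - 1) / 2 = k - 1 := by omega
    have hz : Real.sin ((((k : ℤ) - 1 : ℤ) + 1) * θ) = 0 := by
      have : ((((k : ℤ) - 1 : ℤ) : ℝ) + 1) * θ = Real.pi := by
        rw [hk] at hmθ; push_cast at hmθ ⊢; linarith
      rw [this, Real.sin_pi]
    rw [e1, e2, hS (k - 1), hz]
    simp
  · have e1 : ((m : ℤ) - 2) / 2 = k - 1 := by omega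
    have e2 : ((m : ℤ) - 1) / 2 = k := by omega
    have e3 : ((m : ℤ) - 3) / 2 = k - 1 := by omega
    have e4 : (m : ℤ) / 2 = k := by omega
    have hz : Real.sin (((k : ℤ) + 1) * θ) + Real.sin ((((k : ℤ) - 1 : ℤ) + 1) * θ) = 0 := by
      have : (((k : ℤ) : ℝ) + 1) * θ = 2 * Real.pi - ((((k : ℤ) - 1 : ℤ) : ℝ) + 1) * θ := by
        rw [hk] at hmθ; push_cast at hmθ ⊢; linarith
      rw [this, Real.sin_two_pi_sub]; ring
    rw [e1, e2, e3, e4, hS k, hS (k - 1), ← add_div, hz]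
    simp

end CoxeterMatrix

/-- The sequence `0, 1, 2a, 4a² - 1, …` of values at `a` of the Chebyshev polynomials of the
second kind. -/
noncomputable def chebyshevSeq (a : ℝ) : ℕ → ℝ
  | 0 => 0
  | 1 => 1
  | n + 2 => 2 * a * chebyshevSeq a (n + 1) - chebyshevSeq a n

theorem chebyshevSeq_succ_sub {a : ℝ} (ha : 1 ≤ a) (n : ℕ) :
    0 ≤ chebyshevSeq a n ∧ chebyshevSeq a n + 1 ≤ chebyshevSeq a (n + 1) := by
  induction n with
  | zero => simp [chebyshevSeq]
  | succ n ih =>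
    refine ⟨by linarith, ?_⟩
    rw [chebyshevSeq]
    nlinarith

theorem le_chebyshevSeq {a : ℝ} (ha : 1 ≤ a) (n : ℕ) : (n : ℝ) ≤ chebyshevSeq a n := by
  induction n with
  | zero => simp [chebyshevSeq]
  | succ n ih => push_cast; linarith [(chebyshevSeq_succ_sub ha n).2]

theorem chebyshevSeq_cos_mul_sin (θ : ℝ) (n : ℕ) :
    chebyshevSeq (Real.cos θ) n * Real.sin θ = Real.sin (n * θ) := by
  induction n using Nat.twoStepInduction with
  | zero => simp [chebyshevSeq]
  | one => simp [chebyshevSeq]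
  | more n ih1 ih2 =>
    rw [chebyshevSeq, sub_mul, ih1, mul_assoc, ih2]
    have e1 : ((n + 2 : ℕ) : ℝ) * θ = ((n + 1 : ℕ) : ℝ) * θ + θ := by push_cast; ring
    have e2 : (n : ℝ) * θ = ((n + 1 : ℕ) : ℝ) * θ - θ := by push_cast; ring
    rw [e1, e2, Real.sin_add, Real.sin_sub]
    ring

theorem chebyshevSeq_cos_pi_div_nonneg {m n : ℕ} (hm : m ≠ 1) (h : m = 0 ∨ n ≤ m) :
    0 ≤ chebyshevSeq (Real.cos (Real.pi / m)) n := by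
  by_cases h0 : m = 0
  · simpa [h0] using (chebyshevSeq_succ_sub le_rfl n).1
  have hn : n ≤ m := h.resolve_left h0
  have hm0 : (0 : ℝ) < m := by positivity
  have hm1 : (1 : ℝ) < m := by exact_mod_cast (by omega : 1 < m)
  have hs : 0 < Real.sin (Real.pi / m) := by
    apply Real.sin_pos_of_pos_of_lt_pi
    · positivity
    · rw [div_lt_iff₀ hm0]; nlinarith [Real.pi_pos]
  refine nonneg_of_mul_nonneg_left ?_ hs
  rw [chebyshevSeq_cos_mul_sin]
  apply Real.sin_nonneg_of_nonneg_of_le_pi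
  · positivity
  · rw [mul_div_assoc', div_le_iff₀ hm0, mul_comm]
    gcongr

namespace CoxeterSystem

open CoxeterMatrix

section

variable {B W : Type*} [Group W] {M : CoxeterMatrix B} (cs : CoxeterSystem M W)

/-- The factorization of `w` along the dihedral parabolic generated by `i` and `j`. -/
theorem exists_dihedral_factorization {w : W} {i j : B} (hi : ¬ cs.IsRightDescent w i)
    (hj : cs.IsRightDescent w j) :
    ∃ (k : ℕ) (v : W), w = v * cs.wordProd (alternatingWord i j k) ∧
      cs.length v < cs.length w ∧ ¬ cs.IsRightDescent v i ∧ ¬ cs.IsRightDescent v j ∧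
      (M i j = 0 ∨ k < M i j) := by
  classical
  let Q : ℕ → Prop := fun k =>
    ∃ v, w = v * cs.wordProd (alternatingWord i j k) ∧ cs.length v + k = cs.length w
  have hw (v : W) (k : ℕ) (h : w = v * cs.wordProd (alternatingWord i j k)) :
      cs.length w ≤ cs.length v + k := by
    rw [h]
    refine (cs.length_mul_le _ _).trans ?_
    have := cs.length_wordProd_le (alternatingWord i j k)
    rw [length_alternatingWord] at this
    omega
  have hpeel (v : W) (k : ℕ) (h : w = v * cs.wordProd (alternatingWord i j (k + 1))) :
      w = (v * cs.simple (if Even k then j else i)) * cs.wordProd (alternatingWord i j k) := by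
    rw [h, alternatingWord_succ', wordProd_cons, mul_assoc]
  have hdown (k : ℕ) (h : Q (k + 1)) : Q k := by
    obtain ⟨v, h1, h2⟩ := h
    have h3 := hpeel v k h1
    refine ⟨_, h3, ?_⟩
    have := hw _ _ h3
    have := cs.length_mul_le v (cs.simple (if Even k then j else i))
    rw [length_simple] at this
    omega
  have hdown' (k l : ℕ) (hkl : l ≤ k) (h : Q k) : Q l := by
    induction k, hkl using Nat.le_induction with
    | base => exact h
    | succ k _ ih => exact ih (hdown k h)
  have hQ1 : Q 1 := by
    refine ⟨w * cs.simple j, by simp [alternatingWord], ?_⟩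
    exact (cs.isRightDescent_iff).1 hj
  have hbound (k : ℕ) (h : Q k) : k ≤ cs.length w := by
    obtain ⟨v, -, h⟩ := h; omega
  set k := Nat.findGreatest Q (cs.length w) with hk
  have hQk : Q k := Nat.findGreatest_spec (hbound 1 hQ1) hQ1
  have hk1 : 1 ≤ k := Nat.le_findGreatest (hbound 1 hQ1) hQ1
  have hmax : ¬ Q (k + 1) := fun h => by
    have := Nat.le_findGreatest (hbound _ h) h
    omega
  obtain ⟨v, hv, hlen⟩ := hQk
  have hx : ¬ cs.IsRightDescent v (if Even k then j else i) := by
    intro h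
    apply hmax
    refine ⟨v * cs.simple (if Even k then j else i), ?_, ?_⟩
    · rw [alternatingWord_succ', wordProd_cons]
      simp [← mul_assoc, ← hv]
    · have := (cs.isRightDescent_iff).1 h
      omega
  have hy : ¬ cs.IsRightDescent v (if Even k then i else j) := by
    intro h
    obtain ⟨l, hl⟩ : ∃ l, k = l + 1 := ⟨k - 1, by omega⟩
    have h3 := hpeel v l (hl ▸ hv)
    have := hw _ _ h3
    have h4 := (cs.isRightDescent_iff).1 h
    have e : (if Even k then i else j) = (if Even l then j else i) := by
      rw [hl]; by_cases hl : Even l <;> simp [Nat.even_add_one, hl]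
    rw [e] at h4
    omega
  refine ⟨k, v, hv, by omega, ?_, ?_, ?_⟩
  · by_cases h : Even k
    · simpa [h] using hy
    · simpa [h] using hx
  · by_cases h : Even k
    · simpa [h] using hx
    · simpa [h] using hy
  · by_contra! hcon
    obtain ⟨h0, hle⟩ := hcon
    obtain ⟨v', h1, h2⟩ := hdown' k (M i j) hle ⟨v, hv, hlen⟩
    have hbraid := cs.wordProd_braidWord_eq i j
    simp only [braidWord, M.symmetric j i] at hbraid
    obtain ⟨l, hl⟩ : ∃ l, M i j = l + 1 := ⟨M i j - 1, by omega⟩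
    rw [hbraid, hl, alternatingWord_succ, wordProd_concat] at h1
    apply hi
    have h5 : w * cs.simple i = v' * cs.wordProd (alternatingWord i j l) := by
      rw [h1]; simp [mul_assoc]
    rw [IsRightDescent, h5]
    have := cs.length_mul_le v' (cs.wordProd (alternatingWord i j l))
    have := cs.length_wordProd_le (alternatingWord i j l)
    rw [length_alternatingWord] at this
    omega

end

variable {B W : Type*} [Fintype B] [DecidableEq B] [Group W] {M : CoxeterMatrix B}
  (cs : CoxeterSystem M W)

/-- The geometric representation. -/
noncomputable def geomRep : W →* ((B → ℝ) ≃ₗ[ℝ] (B → ℝ)) :=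
  cs.lift ⟨M.simpleReflection, M.isLiftable_simpleReflection⟩

theorem geomRep_simple_apply (i : B) (v : B → ℝ) :
    cs.geomRep (cs.simple i) v = v - (2 * M.titsForm (simpleRoot i) v) • simpleRoot i := by
  rw [geomRep, lift_apply_simple, simpleReflection_apply]

theorem geomRep_mul_apply (w w' : W) (v : B → ℝ) :
    cs.geomRep (w * w') v = cs.geomRep w (cs.geomRep w' v) := by
  simp

theorem geomRep_inv_apply_self (w : W) (v : B → ℝ) :
    cs.geomRep w⁻¹ (cs.geomRep w v) = v := by
  rw [← geomRep_mul_apply]; simp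

theorem geomRep_self_apply_inv (w : W) (v : B → ℝ) :
    cs.geomRep w (cs.geomRep w⁻¹ v) = v := by
  rw [← geomRep_mul_apply]; simp

theorem titsForm_geomRep (w : W) (v v' : B → ℝ) :
    M.titsForm (cs.geomRep w v) (cs.geomRep w v') = M.titsForm v v' := by
  induction w using cs.simple_induction_left with
  | one => simp
  | mul_simple_left w i ih =>
    rw [geomRep_mul_apply, geomRep_mul_apply, geomRep_simple_apply, geomRep_simple_apply, ← ih]
    simp only [map_sub, map_smul, LinearMap.sub_apply, LinearMap.smul_apply, smul_eq_mul,
      titsForm_simpleRoot_self]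
    rw [M.titsForm_comm _ (simpleRoot i)]
    ring

theorem geomRep_alternatingWord (i j : B) (k : ℕ) :
    cs.geomRep (cs.wordProd (alternatingWord i j k)) (simpleRoot i) =
      if Even k then
        chebyshevSeq (Real.cos (Real.pi / M i j)) (k + 1) • simpleRoot i +
          chebyshevSeq (Real.cos (Real.pi / M i j)) k • simpleRoot j
      else
        chebyshevSeq (Real.cos (Real.pi / M i j)) k • simpleRoot i +
          chebyshevSeq (Real.cos (Real.pi / M i j)) (k + 1) • simpleRoot j := by
  have hs : M j i = M i j := M.symmetric j i
  induction k with
  | zero => simp [alternatingWord, chebyshevSeq]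
  | succ k ih =>
    rw [alternatingWord_succ', wordProd_cons, geomRep_mul_apply, ih, geomRep_simple_apply]
    by_cases hk : Even k
    · have hk' : ¬ Even (k + 1) := by simpa [Nat.even_add_one] using hk
      simp only [hk, hk', if_true, if_false, map_add, map_smul, titsForm_simpleRoot_self,
        titsForm_simpleRoot, hs, chebyshevSeq, smul_eq_mul]
      module
    · have hk' : Even (k + 1) := by simpa [Nat.even_add_one] using hk
      simp only [hk, hk', if_true, if_false, map_add, map_smul, titsForm_simpleRoot_self,
        titsForm_simpleRoot, chebyshevSeq, smul_eq_mul]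
      module

theorem geomRep_simpleRoot_nonneg {w : W} {i : B} (h : ¬ cs.IsRightDescent w i) :
    0 ≤ cs.geomRep w (simpleRoot i) := by
  induction hn : cs.length w using Nat.strong_induction_on generalizing w i with
  | _ n ih =>
  by_cases hw : w = 1
  · simp [hw, simpleRoot_nonneg]
  obtain ⟨j, hj⟩ := cs.exists_rightDescent_of_ne_one hw
  have hij : i ≠ j := by rintro rfl; exact h hj
  obtain ⟨k, v, hv, hlt, hvi, hvj, hk⟩ := cs.exists_dihedral_factorization h hj
  have hi0 := ih _ (hn ▸ hlt) hvi rfl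
  have hj0 := ih _ (hn ▸ hlt) hvj rfl
  have hm1 := M.off_diagonal i j hij
  have c1 := chebyshevSeq_cos_pi_div_nonneg (n := k) hm1 (by omega)
  have c2 := chebyshevSeq_cos_pi_div_nonneg (n := k + 1) hm1 (by omega)
  rw [hv, geomRep_mul_apply, geomRep_alternatingWord]
  split_ifs
  · rw [map_add, map_smul, map_smul]
    exact add_nonneg (smul_nonneg c2 hi0) (smul_nonneg c1 hj0)
  · rw [map_add, map_smul, map_smul]
    exact add_nonneg (smul_nonneg c1 hi0) (smul_nonneg c2 hj0)

theorem geomRep_simpleRoot_nonpos {w : W} {i : B} (h : cs.IsRightDescent w i) :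
    cs.geomRep w (simpleRoot i) ≤ 0 := by
  have h' := cs.geomRep_simpleRoot_nonneg ((cs.isRightDescent_iff_not_isRightDescent_mul).1 h)
  rw [geomRep_mul_apply, geomRep_simple_apply, titsForm_simpleRoot_self, map_sub, map_smul] at h'
  intro j
  have := h' j
  simp at this ⊢
  linarith

end CoxeterSystem

namespace CoxeterSystem

open CoxeterMatrix

variable {B W : Type*} [Fintype B] [DecidableEq B] [Group W] {M : CoxeterMatrix B}
  (cs : CoxeterSystem M W)

/-- The roots: the orbit of the simple roots under the geometric representation. -/
def IsRoot (v : B → ℝ) : Prop :=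
  ∃ w i, v = cs.geomRep w (simpleRoot i)

theorem isRoot_simpleRoot (i : B) : cs.IsRoot (simpleRoot i) := ⟨1, i, by simp⟩

variable {cs}

theorem IsRoot.geomRep {v : B → ℝ} (hv : cs.IsRoot v) (w : W) : cs.IsRoot (cs.geomRep w v) := by
  obtain ⟨w', i, rfl⟩ := hv
  exact ⟨w * w', i, by simp⟩

theorem IsRoot.titsForm_self {v : B → ℝ} (hv : cs.IsRoot v) : M.titsForm v v = 1 := by
  obtain ⟨w, i, rfl⟩ := hv
  rw [titsForm_geomRep, titsForm_simpleRoot_self]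

theorem IsRoot.ne_zero {v : B → ℝ} (hv : cs.IsRoot v) : v ≠ 0 := by
  rintro rfl
  simpa using hv.titsForm_self

theorem IsRoot.neg {v : B → ℝ} (hv : cs.IsRoot v) : cs.IsRoot (-v) := by
  obtain ⟨w, i, rfl⟩ := hv
  refine ⟨w * cs.simple i, i, ?_⟩
  rw [geomRep_mul_apply, geomRep_simple_apply, titsForm_simpleRoot_self, ← map_neg]
  congr 1
  module

theorem IsRoot.nonneg_or_nonpos {v : B → ℝ} (hv : cs.IsRoot v) : 0 ≤ v ∨ v ≤ 0 := by
  obtain ⟨w, i, rfl⟩ := hv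
  by_cases h : cs.IsRightDescent w i
  · exact Or.inr (cs.geomRep_simpleRoot_nonpos h)
  · exact Or.inl (cs.geomRep_simpleRoot_nonneg h)

theorem IsRoot.not_nonneg_iff {v : B → ℝ} (hv : cs.IsRoot v) : ¬ 0 ≤ v ↔ v ≤ 0 :=
  ⟨hv.nonneg_or_nonpos.resolve_left, fun h h' => hv.ne_zero (le_antisymm h h')⟩

theorem IsRoot.exists_reflection {v : B → ℝ} (hv : cs.IsRoot v) :
    ∃ r : W, ∀ x, cs.geomRep r x = x - (2 * M.titsForm v x) • v := by
  obtain ⟨w, i, rfl⟩ := hv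
  refine ⟨w * cs.simple i * w⁻¹, fun x => ?_⟩
  rw [geomRep_mul_apply, geomRep_mul_apply, geomRep_simple_apply, map_sub, map_smul,
    geomRep_self_apply_inv, ← cs.titsForm_geomRep w (simpleRoot i), geomRep_self_apply_inv]

theorem IsRoot.sub_smul {v v' : B → ℝ} (hv : cs.IsRoot v) (hv' : cs.IsRoot v') :
    cs.IsRoot (v' - (2 * M.titsForm v v') • v) := by
  obtain ⟨r, hr⟩ := hv.exists_reflection
  exact hr v' ▸ hv'.geomRep r

variable (cs)

/-- The positive roots made negative by `w`. -/
def inversionSet (w : W) : Set (B → ℝ) :=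
  {v | cs.IsRoot v ∧ 0 ≤ v ∧ cs.geomRep w v ≤ 0}

theorem eq_simpleRoot_of_mem_inversionSet_simple {v : B → ℝ} {i : B}
    (h : v ∈ cs.inversionSet (cs.simple i)) : v = simpleRoot i := by
  obtain ⟨hv, h0, h1⟩ := h
  have hk (k : B) (hk : k ≠ i) : v k = 0 := by
    refine le_antisymm ?_ (h0 k)
    simpa [geomRep_simple_apply, simpleRoot, hk] using h1 k
  have hvi : v = v i • simpleRoot i := by
    ext k
    by_cases h : k = i
    · subst h; simp [simpleRoot]
    · simp [simpleRoot, hk k h, h]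
  have hsq := hv.titsForm_self
  rw [hvi] at hsq
  simp only [map_smul, LinearMap.smul_apply, titsForm_simpleRoot_self, smul_eq_mul] at hsq
  have : v i = 1 := by
    have : 0 ≤ v i := h0 i
    nlinarith
  rw [hvi, this, one_smul]

theorem finite_inversionSet (w : W) : (cs.inversionSet w).Finite := by
  induction w using cs.simple_induction_left with
  | one =>
    convert Set.finite_empty (α := B → ℝ)
    ext v
    simp only [inversionSet, Set.mem_ofPred_eq, map_one, LinearEquiv.coe_one, id_eq,
      Set.mem_empty_iff_false, iff_false]
    rintro ⟨h, h0, h1⟩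
    exact h.not_nonneg_iff.2 h1 h0
  | mul_simple_left w i ih =>
    refine (ih.union (Set.finite_singleton (cs.geomRep w⁻¹ (simpleRoot i)))).subset ?_
    rintro v ⟨hv, h0, h1⟩
    by_cases h : cs.geomRep w v ≤ 0
    · exact Or.inl ⟨hv, h0, h⟩
    · have hr := hv.geomRep w
      right
      rw [geomRep_mul_apply] at h1
      have := cs.eq_simpleRoot_of_mem_inversionSet_simple
        ⟨hr, hr.nonneg_or_nonpos.resolve_right h, h1⟩
      rw [Set.mem_singleton_iff, ← this, geomRep_inv_apply_self]

theorem eq_one_of_inversionSet_eq_empty {w : W} (h : cs.inversionSet w = ∅) : w = 1 := by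
  by_contra hw
  obtain ⟨i, hi⟩ := cs.exists_rightDescent_of_ne_one hw
  have : simpleRoot i ∈ cs.inversionSet w :=
    ⟨cs.isRoot_simpleRoot i, simpleRoot_nonneg i, cs.geomRep_simpleRoot_nonpos hi⟩
  rw [h] at this
  exact this

variable {cs}

/-- The orbit of two roots under the dihedral group they generate. -/
theorem IsRoot.chebyshevSeq {α β : B → ℝ} (hα : cs.IsRoot α) (hβ : cs.IsRoot β) {a : ℝ}
    (ha : M.titsForm α β = -a) (n : ℕ) :
    cs.IsRoot (chebyshevSeq a (n + 1) • α + chebyshevSeq a n • β) ∧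
      cs.IsRoot (chebyshevSeq a n • α + chebyshevSeq a (n + 1) • β) := by
  have ha' : M.titsForm β α = -a := by rw [M.titsForm_comm, ha]
  induction n with
  | zero => simpa [_root_.chebyshevSeq] using ⟨hα, hβ⟩
  | succ n ih =>
    constructor
    · convert hα.sub_smul ih.2 using 1
      simp only [map_add, map_smul, hα.titsForm_self, ha, _root_.chebyshevSeq, smul_eq_mul]
      module
    · convert hβ.sub_smul ih.1 using 1
      simp only [map_add, map_smul, hβ.titsForm_self, ha', _root_.chebyshevSeq, smul_eq_mul]
      module

theorem IsRoot.sum_pos {v : B → ℝ} (hv : cs.IsRoot v) (h : 0 ≤ v) : 0 < ∑ i, v i := by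
  refine lt_of_le_of_ne (Finset.sum_nonneg fun i _ => h i) fun h0 => hv.ne_zero ?_
  ext i
  exact (Finset.sum_eq_zero_iff_of_nonneg fun i _ => h i).1 h0.symm i (Finset.mem_univ i)

/-- Two facing positive roots are never both inverted. -/
theorem IsRoot.not_both_inverted {α β : B → ℝ} (hα : cs.IsRoot α) (hβ : cs.IsRoot β)
    (h : M.titsForm α β ≤ -1) (hα0 : 0 ≤ α) (hβ0 : 0 ≤ β) (w : W)
    (hwα : cs.geomRep w α ≤ 0) (hwβ : cs.geomRep w β ≤ 0) : False := by
  set a := -M.titsForm α β with ha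
  have ha1 : 1 ≤ a := by linarith
  have hc := chebyshevSeq_succ_sub ha1
  let f : ℕ → B → ℝ := fun n => _root_.chebyshevSeq a (n + 1) • α + _root_.chebyshevSeq a n • β
  have hf (n : ℕ) : f n ∈ cs.inversionSet w := by
    refine ⟨(hα.chebyshevSeq hβ (by rw [ha, neg_neg]) n).1,
      add_nonneg (smul_nonneg (hc _).1 hα0) (smul_nonneg (hc _).1 hβ0), ?_⟩
    simp only [f, map_add, map_smul]
    exact add_nonpos (smul_nonpos_of_nonneg_of_nonpos (hc _).1 hwα)
      (smul_nonpos_of_nonneg_of_nonpos (hc _).1 hwβ)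
  have hmono : StrictMono fun n => ∑ i, f n i := by
    refine strictMono_nat_of_lt_succ fun n => ?_
    simp only [f, Pi.add_apply, Pi.smul_apply, smul_eq_mul, Finset.sum_add_distrib,
      ← Finset.mul_sum]
    have h1 := hα.sum_pos hα0
    have h2 := hβ.sum_pos hβ0
    have h3 := (hc n).2
    have h4 := (hc (n + 1)).2
    nlinarith
  have hinj : Function.Injective f := fun m n hmn => hmono.injective (by simp only [hmn])
  exact Set.infinite_of_injective_forall_mem hinj hf (cs.finite_inversionSet w)

end CoxeterSystem

namespace CoxeterSystem

open CoxeterMatrix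

section

variable {B W : Type*} [Group W] {M : CoxeterMatrix B} (cs : CoxeterSystem M W)

/-- A free family of words of linearly bounded length forces exponential growth. -/
theorem exists_not_summable_of_injective {p : List Bool → W} (hp : Function.Injective p) {L : ℕ}
    (hL : ∀ l, cs.length (p l) ≤ L * l.length) :
    ∃ x : ℝ, 0 < x ∧ x < 1 ∧ ¬ Summable (fun w : W => x ^ cs.length w) := by
  set x : ℝ := 1 - 1 / (4 * (L + 1)) with hx
  have hL0 : (0 : ℝ) ≤ L := Nat.cast_nonneg L
  have hpos : (0 : ℝ) < 1 / (4 * (L + 1)) := by positivity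
  have hle : 1 / (4 * ((L : ℝ) + 1)) ≤ 1 / 4 := by
    rw [div_le_div_iff₀ (by positivity) (by norm_num)]; nlinarith
  have hx0 : 0 < x := by linarith
  have hx1 : x < 1 := by linarith
  have hxL : 3 / 4 ≤ x ^ L := by
    have := one_add_mul_le_pow (a := -(1 / (4 * ((L : ℝ) + 1)))) (by linarith) L
    rw [← sub_eq_add_neg] at this
    refine le_trans ?_ this
    have : (L : ℝ) * (1 / (4 * (L + 1))) ≤ 1 / 4 := by
      rw [mul_one_div, div_le_div_iff₀ (by positivity) (by norm_num)]; nlinarith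
    linarith
  refine ⟨x, hx0, hx1, fun hsum => ?_⟩
  have hs := hsum.comp_injective hp
  have hbound (n : ℕ) : (3 / 2 : ℝ) ^ n ≤ ∑' l, ((fun w : W => x ^ cs.length w) ∘ p) l := by
    refine le_trans ?_ (hs.sum_le_tsum
      (Finset.univ.map ⟨(List.ofFn : (Fin n → Bool) → List Bool), List.ofFn_injective⟩)
      fun l _ => pow_nonneg hx0.le _)
    rw [Finset.sum_map]
    have : ∀ f ∈ (Finset.univ : Finset (Fin n → Bool)), (3 / 4 : ℝ) ^ n ≤
        ((fun w : W => x ^ cs.length w) ∘ p)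
          ((⟨List.ofFn, List.ofFn_injective⟩ : (Fin n → Bool) ↪ List Bool) f) := by
      intro f _
      simp only [Function.Embedding.coeFn_mk, Function.comp_apply]
      calc (3 / 4 : ℝ) ^ n ≤ (x ^ L) ^ n := by gcongr
        _ = x ^ (L * n) := by rw [pow_mul]
        _ ≤ _ := by
          apply pow_le_pow_of_le_one hx0.le hx1.le
          simpa using hL (List.ofFn f)
    refine le_trans ?_ (Finset.card_nsmul_le_sum _ _ _ this)
    simp only [Finset.card_univ, Fintype.card_pi, Fintype.card_bool, Finset.prod_const,
      Fintype.card_fin, nsmul_eq_mul]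
    push_cast
    rw [← mul_pow]
    norm_num
  obtain ⟨n, hn⟩ := pow_unbounded_of_one_lt (∑' l, ((fun w : W => x ^ cs.length w) ∘ p) l)
    (by norm_num : (1 : ℝ) < 3 / 2)
  exact absurd (hbound n) (not_le.2 hn)

end

variable {B W : Type*} [Fintype B] [DecidableEq B] [Group W] {M : CoxeterMatrix B}
  {cs : CoxeterSystem M W}

/-- Three pairwise facing roots produce a free subsemigroup, hence exponential growth. -/
theorem exists_not_summable_of_facing {α : Fin 3 → B → ℝ} (hα : ∀ i, cs.IsRoot (α i))
    (h : ∀ i j, i ≠ j → M.titsForm (α i) (α j) ≤ -1) :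
    ∃ x : ℝ, 0 < x ∧ x < 1 ∧ ¬ Summable (fun w : W => x ^ cs.length w) := by
  choose r hr using fun i => (hα i).exists_reflection
  let X : Fin 3 → (B → ℝ) → Prop := fun i y =>
    M.titsForm y (α i) < 0 ∧ ∀ j, j ≠ i → 0 < M.titsForm y (α i) + M.titsForm y (α j)
  have hrinv (i : Fin 3) (y z : B → ℝ) :
      M.titsForm (cs.geomRep (r i) y) z = M.titsForm y (cs.geomRep (r i) z) := by
    rw [hr, hr]
    simp only [map_sub, map_smul, LinearMap.sub_apply, LinearMap.smul_apply, smul_eq_mul]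
    rw [M.titsForm_comm y (α i)]
    ring
  have hval (k j : Fin 3) (y : B → ℝ) : M.titsForm (cs.geomRep (r k) y) (α j) =
      M.titsForm y (α j) - 2 * M.titsForm (α k) (α j) * M.titsForm y (α k) := by
    rw [hrinv, hr]
    simp
  have hself (k : Fin 3) (y : B → ℝ) :
      M.titsForm (cs.geomRep (r k) y) (α k) = - M.titsForm y (α k) := by
    rw [hval, (hα k).titsForm_self]; ring
  have hstep (k : Fin 3) (y : B → ℝ) (hk : 0 < M.titsForm y (α k))
      (hj : ∀ j, j ≠ k → 0 < M.titsForm y (α j) + M.titsForm y (α k)) :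
      X k (cs.geomRep (r k) y) := by
    refine ⟨by rw [hself]; linarith, fun j hjk => ?_⟩
    rw [hself, hval]
    have := h k j hjk.symm
    have := hj j hjk
    nlinarith
  have hX (i k : Fin 3) (hik : i ≠ k) (y : B → ℝ) (hy : X i y) : X k (cs.geomRep (r k) y) := by
    have hpos (j : Fin 3) (hj : j ≠ i) : 0 < M.titsForm y (α j) := by
      linarith [hy.1, hy.2 j hj]
    refine hstep k y (hpos k hik.symm) fun j hj => ?_
    by_cases hji : j = i
    · subst hji; exact hy.2 k hj.symm
    · linarith [hpos j hji, hpos k hik.symm]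
  let y₀ : B → ℝ := -(α 0 + α 1 + α 2)
  have h01 := h 0 1 (by decide)
  have h02 := h 0 2 (by decide)
  have h12 := h 1 2 (by decide)
  have h10 := h 1 0 (by decide)
  have h20 := h 2 0 (by decide)
  have h21 := h 2 1 (by decide)
  have hy₀ (i : Fin 3) : 0 < M.titsForm y₀ (α i) := by
    simp only [y₀, map_neg, map_add, LinearMap.neg_apply, LinearMap.add_apply]
    fin_cases i
    · simp only [Fin.zero_eta, (hα 0).titsForm_self]; linarith
    · simp only [Fin.mk_one, (hα 1).titsForm_self]; linarith
    · simp only [Fin.reduceFinMk, (hα 2).titsForm_self]; linarith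
  let c : Bool → Fin 3 := fun b => if b then 1 else 2
  have hc0 (b : Bool) : (0 : Fin 3) ≠ c b := by cases b <;> decide
  have hcinj : Function.Injective c := by decide
  let g : Bool → W := fun b => r (c b) * r 0
  let p : List Bool → W := fun l => l.foldr (fun b w => g b * w) 1
  have hp (b : Bool) (l : List Bool) : p (b :: l) = g b * p l := rfl
  have hpX (b : Bool) (l : List Bool) : X (c b) (cs.geomRep (p (b :: l)) y₀) := by
    induction l generalizing b with
    | nil =>
      simp only [hp, g, p, List.foldr_nil, mul_one, geomRep_mul_apply]
      exact hX 0 _ (hc0 b) _ (hstep 0 _ (hy₀ 0) fun j _ => add_pos (hy₀ j) (hy₀ 0))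
    | cons b' l ih =>
      rw [hp, geomRep_mul_apply, geomRep_mul_apply]
      exact hX 0 _ (hc0 b) _ (hX _ 0 (hc0 b').symm _ (ih b'))
  have hXdisj (i j : Fin 3) (y : B → ℝ) (hi : X i y) (hj : X j y) : i = j := by
    by_contra hij
    linarith [hi.1, hi.2 j (Ne.symm hij), hj.1]
  have hpinj : Function.Injective p := by
    intro l
    induction l with
    | nil =>
      rintro (_ | ⟨b, l'⟩) hl
      · rfl
      · have := (hpX b l').1
        rw [← hl] at this
        simp only [p, List.foldr_nil, map_one, LinearEquiv.coe_one, id_eq] at this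
        linarith [hy₀ (c b)]
    | cons b l ih =>
      rintro (_ | ⟨b', l'⟩) hl
      · have := (hpX b l).1
        rw [hl] at this
        simp only [p, List.foldr_nil, map_one, LinearEquiv.coe_one, id_eq] at this
        linarith [hy₀ (c b)]
      · have h1 := hpX b l
        rw [hl] at h1
        have hb := hcinj (hXdisj _ _ _ h1 (hpX b' l'))
        subst hb
        rw [hp, hp, mul_right_inj] at hl
        rw [ih hl]
  refine cs.exists_not_summable_of_injective hpinj (L := cs.length (g true) + cs.length (g false))
    fun l => ?_
  induction l with
  | nil => simp [p]
  | cons b l ih =>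
    rw [hp, List.length_cons, mul_add, mul_one]
    have h1 := cs.length_mul_le (g b) (p l)
    have h2 : cs.length (g b) ≤ cs.length (g true) + cs.length (g false) := by
      cases b <;> omega
    omega

variable (cs) in
/-- No three roots are pairwise facing. -/
def NoFacingTriple : Prop :=
  ∀ α β γ : B → ℝ, cs.IsRoot α → cs.IsRoot β → cs.IsRoot γ → M.titsForm α β ≤ -1 →
    M.titsForm α γ ≤ -1 → M.titsForm β γ ≤ -1 → False

/-- In the absence of facing triples, two roots facing a common root are parallel. -/
theorem NoFacingTriple.one_le_titsForm_of_facing (hN : cs.NoFacingTriple)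
    {α β γ : B → ℝ} (hα : cs.IsRoot α) (hβ : cs.IsRoot β) (hγ : cs.IsRoot γ)
    (hαβ : M.titsForm α β ≤ -1) (hγβ : M.titsForm γ β ≤ -1) : 1 ≤ M.titsForm α γ := by
  by_contra! hc1
  have key (a : ℝ) (ha : 1 ≤ a) : ∃ t : ℝ, 1 ≤ t ∧ t ^ 2 + 1 = 2 * a * t ∧ ∀ n,
      0 ≤ chebyshevSeq a (n + 1) - t * chebyshevSeq a n ∧
        chebyshevSeq a (n + 1) - t * chebyshevSeq a n ≤ 1 := by
    have hsq : 0 ≤ a ^ 2 - 1 := by nlinarith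
    refine ⟨a + √(a ^ 2 - 1), by linarith [Real.sqrt_nonneg (a ^ 2 - 1)], ?_, ?_⟩
    · linear_combination Real.sq_sqrt hsq
    set t := a + √(a ^ 2 - 1)
    have ht1 : 1 ≤ t := by linarith [Real.sqrt_nonneg (a ^ 2 - 1)]
    have ht : t ^ 2 + 1 = 2 * a * t := by
      simp only [t]; linear_combination Real.sq_sqrt hsq
    intro n
    induction n with
    | zero => simp [chebyshevSeq]
    | succ n ih =>
      have e : t * (chebyshevSeq a (n + 1 + 1) - t * chebyshevSeq a (n + 1)) =
          chebyshevSeq a (n + 1) - t * chebyshevSeq a n := by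
        rw [chebyshevSeq]
        linear_combination (-chebyshevSeq a (n + 1)) * ht
      rw [← e] at ih
      constructor
      · exact nonneg_of_mul_nonneg_right ih.1 (by linarith)
      · by_contra! hcon
        nlinarith
  obtain ⟨a, ha⟩ : ∃ a, M.titsForm α β = -a := ⟨_, (neg_neg _).symm⟩
  obtain ⟨b, hb⟩ : ∃ b, M.titsForm γ β = -b := ⟨_, (neg_neg _).symm⟩
  set c := M.titsForm α γ with hc
  have ha1 : 1 ≤ a := by linarith
  have hb1 : 1 ≤ b := by linarith
  obtain ⟨s, hs1, hs, hsn⟩ := key a ha1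
  obtain ⟨t, ht1, ht, htn⟩ := key b hb1
  have hroot (n : ℕ) := (hα.chebyshevSeq hβ ha n).1
  have hroot' (n : ℕ) := (hγ.chebyshevSeq hβ hb n).1
  set Q := s * t * c - (s ^ 2 + t ^ 2) / 2 with hQ
  have hQ0 : Q < 0 := by
    nlinarith [sq_nonneg (s - t), mul_pos (by linarith : 0 < s) (by linarith : 0 < t)]
  set R := |t * c - a| + |s * c - b| + |c| + 1 with hR
  obtain ⟨n, hn⟩ := exists_nat_ge (2 * R / (-Q))
  rw [div_le_iff₀ (by linarith)] at hn
  have hA := abs_nonneg (t * c - a)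
  have hB := abs_nonneg (s * c - b)
  have hC := abs_nonneg c
  have hR1 : 1 ≤ R := by linarith
  have hUn := le_chebyshevSeq ha1 n
  have hVn := le_chebyshevSeq hb1 n
  have hn1 : (1 : ℝ) ≤ n := by
    rcases Nat.eq_zero_or_pos n with rfl | h
    · simp at hn; linarith
    · exact_mod_cast h
  obtain ⟨hU0, hU'⟩ := chebyshevSeq_succ_sub ha1 n
  obtain ⟨hV0, hV'⟩ := chebyshevSeq_succ_sub hb1 n
  obtain ⟨hε0, hε1⟩ := hsn n
  obtain ⟨hδ0, hδ1⟩ := htn n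
  have hβα : M.titsForm β α = -a := by rw [M.titsForm_comm, ha]
  have hβγ : M.titsForm β γ = -b := by rw [M.titsForm_comm, hb]
  refine hN _ _ _ (hroot n) (hroot' n) hβ ?_ ?_ ?_
  · simp only [map_add, map_smul, LinearMap.add_apply, LinearMap.smul_apply, smul_eq_mul,
      hβ.titsForm_self, hβγ, ← hc, ha]
    generalize chebyshevSeq a (n + 1) = U' at *
    generalize chebyshevSeq b (n + 1) = V' at *
    generalize chebyshevSeq a n = U at *
    generalize chebyshevSeq b n = V at *
    obtain ⟨ε, rfl⟩ : ∃ ε, U' = s * U + ε := ⟨U' - s * U, by ring⟩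
    obtain ⟨δ, rfl⟩ : ∃ δ, V' = t * V + δ := ⟨V' - t * V, by ring⟩
    rw [add_sub_cancel_left] at hε0 hε1 hδ0 hδ1
    have e1 : δ * (s * c - b) ≤ |s * c - b| :=
      (mul_le_mul_of_nonneg_left (le_abs_self _) hδ0).trans (mul_le_of_le_one_left hB hδ1)
    have e2 : ε * (t * c - a) ≤ |t * c - a| :=
      (mul_le_mul_of_nonneg_left (le_abs_self _) hε0).trans (mul_le_of_le_one_left hA hε1)
    have e3 : ε * δ * c ≤ |c| :=
      (mul_le_mul_of_nonneg_left (le_abs_self _) (mul_nonneg hε0 hδ0)).trans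
        (mul_le_of_le_one_left hC (mul_le_one₀ hε1 hδ0 hδ1))
    have e4 := mul_le_mul_of_nonneg_left e1 hU0
    have e5 := mul_le_mul_of_nonneg_left e2 hV0
    have e6 : U * (2 * R) ≤ U * (V * -Q) := mul_le_mul_of_nonneg_left
      (hn.trans (mul_le_mul_of_nonneg_right hVn (by linarith))) hU0
    have e7 : V * (2 * R) ≤ V * (U * -Q) := mul_le_mul_of_nonneg_left
      (hn.trans (mul_le_mul_of_nonneg_right hUn (by linarith))) hV0
    have e8 : U * R = U * |t * c - a| + U * |s * c - b| + U * |c| + U := by rw [hR]; ring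
    have e9 : V * R = V * |t * c - a| + V * |s * c - b| + V * |c| + V := by rw [hR]; ring
    have e10 := mul_nonneg hU0 hA
    have e11 := mul_nonneg hV0 hB
    have e12 := mul_nonneg hV0 hC
    have e13 : |c| ≤ U * |c| := le_mul_of_one_le_left hC (hn1.trans hUn)
    have e14 : (s * U + ε) * ((t * V + δ) * c + V * -a) + U * ((t * V + δ) * -b + V) =
        U * V * Q + U * (δ * (s * c - b)) + V * (ε * (t * c - a)) + ε * δ * c := by
      rw [hQ]; linear_combination (U * V / 2) * hs + (U * V / 2) * ht
    nlinarith only [e3, e4, e5, e6, e7, e8, e9, e10, e11, e12, e13, e14, hUn, hVn, hn1]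
  · simp only [map_add, map_smul, LinearMap.add_apply, LinearMap.smul_apply, smul_eq_mul,
      hβ.titsForm_self, ha]
    nlinarith only [ha1, hU', hU0]
  · simp only [map_add, map_smul, LinearMap.add_apply, LinearMap.smul_apply, smul_eq_mul,
      hβ.titsForm_self, hb]
    nlinarith only [hb1, hV', hV0]

end CoxeterSystem

theorem not_forall_pos_of_recurrence {h : ℕ → ℝ} {e : ℝ} (he : e < 1)
    (hrec : ∀ n, h (n + 2) + h n = 2 * e * h (n + 1)) : ¬ ∀ n, 0 < h n := by
  intro hpos
  have hd (m k : ℕ) : h (m + k + 1) - h (m + k) ≤ h (m + 1) - h m := by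
    induction k with
    | zero => simp
    | succ k ih =>
      have := hrec (m + k)
      have := mul_pos (sub_pos.2 he) (hpos (m + k + 1))
      simp only [← add_assoc] at *
      linarith
  have hmono (m : ℕ) : 0 ≤ h (m + 1) - h m := by
    by_contra! hm
    have hk (k : ℕ) : h (m + k) ≤ h m + k * (h (m + 1) - h m) := by
      induction k with
      | zero => simp
      | succ k ih =>
        have := hd m k
        push_cast
        simp only [← add_assoc] at *
        linarith
    obtain ⟨k, hk'⟩ := exists_nat_ge (h m / -(h (m + 1) - h m))
    rw [div_le_iff₀ (by linarith)] at hk'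
    linarith [hk k, hpos (m + k)]
  have h0 (n : ℕ) : h 0 ≤ h n := by
    induction n with
    | zero => rfl
    | succ n ih => linarith [hmono n]
  have hlin (n : ℕ) : h (n + 1) - h n ≤ h 1 - h 0 - n * (2 * (1 - e) * h 0) := by
    induction n with
    | zero => simp
    | succ n ih =>
      have := hrec n
      have := mul_le_mul_of_nonneg_left (h0 (n + 1)) (sub_pos.2 he).le
      push_cast
      linarith
  obtain ⟨n, hn⟩ := exists_nat_gt ((h 1 - h 0) / (2 * (1 - e) * h 0))
  rw [div_lt_iff₀ (by have := mul_pos (sub_pos.2 he) (hpos 0); linarith)] at hn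
  linarith [hlin n, hmono n]

namespace CoxeterSystem

open CoxeterMatrix

variable {B W : Type*} [Fintype B] [DecidableEq B] [Group W] {M : CoxeterMatrix B}
  {cs : CoxeterSystem M W}

theorem IsRoot.exists_pow_not_nonneg {v : B → ℝ} (hv : cs.IsRoot v) {w : W} {e : ℝ} (he : e < 1)
    (hw : cs.geomRep w (cs.geomRep w v) + v = (2 * e) • cs.geomRep w v) :
    ∃ n : ℕ, ¬ 0 ≤ cs.geomRep (w ^ n) v := by
  by_contra! hpos
  refine not_forall_pos_of_recurrence (h := fun n => ∑ i, cs.geomRep (w ^ n) v i) he (fun n => ?_)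
    fun n => (hv.geomRep _).sum_pos (hpos n)
  have := congrArg (cs.geomRep (w ^ n)) hw
  simp only [map_add, map_smul, ← geomRep_mul_apply, ← mul_assoc, ← pow_succ] at this
  have := congrArg (fun u : B → ℝ => ∑ i, u i) this
  simpa only [Pi.add_apply, Pi.smul_apply, smul_eq_mul, Finset.sum_add_distrib,
    ← Finset.mul_sum] using this

theorem IsRoot.exists_pow_eq_self {v : B → ℝ} (hv : cs.IsRoot v) {w : W} {e : ℝ} (he : e < 1)
    (hw : cs.geomRep w (cs.geomRep w v) + v = (2 * e) • cs.geomRep w v) :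
    ∃ n : ℕ, 0 < n ∧ cs.geomRep (w ^ n) v = v := by
  by_contra! hne
  have hinj : Function.Injective fun n : ℕ => cs.geomRep (w ^ n) v := by
    refine Function.Injective.of_lt_imp_ne fun m n hmn h => hne (n - m) (by omega) ?_
    rw [← Nat.add_sub_cancel' hmn.le, pow_add, geomRep_mul_apply] at h
    exact ((cs.geomRep (w ^ m)).injective h).symm
  have hfin : {n : ℕ | cs.geomRep (w ^ n) v ∈ cs.inversionSet w ∪ -cs.inversionSet w}.Finite :=
    ((cs.finite_inversionSet w).union (cs.finite_inversionSet w).neg).preimage hinj.injOn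
  obtain ⟨m, hm⟩ := hfin.bddAbove
  have hgt (n : ℕ) : cs.geomRep (w ^ (m + 1 + n)) v ∉ cs.inversionSet w ∪ -cs.inversionSet w := by
    intro h
    have := hm h
    omega
  have hsucc (n : ℕ) : cs.geomRep (w ^ (n + 1)) v = cs.geomRep w (cs.geomRep (w ^ n) v) := by
    rw [pow_succ', geomRep_mul_apply]
  have hadd (n : ℕ) : cs.geomRep (w ^ n) (cs.geomRep (w ^ (m + 1)) v) =
      cs.geomRep (w ^ (m + 1 + n)) v := by
    rw [← geomRep_mul_apply, ← pow_add, add_comm]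
  have hw' : cs.geomRep w (cs.geomRep w (cs.geomRep (w ^ (m + 1)) v)) +
      cs.geomRep (w ^ (m + 1)) v = (2 * e) • cs.geomRep w (cs.geomRep (w ^ (m + 1)) v) := by
    have := congrArg (cs.geomRep (w ^ (m + 1))) hw
    simp only [map_add, map_smul, ← geomRep_mul_apply, ← mul_assoc, ← pow_succ] at this
    rwa [hsucc (m + 1 + 1), hsucc (m + 1)] at this
  rcases (hv.geomRep (w ^ (m + 1))).nonneg_or_nonpos with h | h
  · obtain ⟨n, hn⟩ := (hv.geomRep (w ^ (m + 1))).exists_pow_not_nonneg he hw'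
    refine hn ?_
    clear hn
    rw [hadd]
    induction n with
    | zero => exact h
    | succ n ih =>
      by_contra hcon
      refine hgt n (Or.inl ⟨hv.geomRep _, ih, ?_⟩)
      rw [← hsucc]
      exact ((hv.geomRep _).not_nonneg_iff).1 hcon
  · obtain ⟨n, hn⟩ := (hv.geomRep (w ^ (m + 1))).neg.exists_pow_not_nonneg (w := w) he (by
      rw [map_neg, map_neg, ← neg_add, hw', smul_neg])
    refine hn ?_
    clear hn
    rw [map_neg, hadd, neg_nonneg]
    induction n with
    | zero => exact h
    | succ n ih =>
      by_contra hcon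
      refine hgt n (Or.inr ⟨(hv.geomRep _).neg, neg_nonneg.2 ih, ?_⟩)
      rw [map_neg, ← hsucc, neg_nonpos]
      exact (hv.geomRep _).nonneg_or_nonpos.resolve_right hcon

/-- Two roots spanning a positive definite plane lie on the zero locus of a linear form
which is positive on all but finitely many positive roots. -/
theorem IsRoot.exists_linearMap {α β : B → ℝ} (hα : cs.IsRoot α) (hβ : cs.IsRoot β)
    (h : |M.titsForm α β| < 1) :
    ∃ F : (B → ℝ) →ₗ[ℝ] ℝ, F α = 0 ∧ F β = 0 ∧
      {v | cs.IsRoot v ∧ 0 ≤ v ∧ F v ≤ 0}.Finite := by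
  obtain ⟨c, hc⟩ : ∃ c, M.titsForm α β = c := ⟨_, rfl⟩
  have hc' : M.titsForm β α = c := by rw [M.titsForm_comm, hc]
  rw [hc, abs_lt] at h
  have hc2 : c ^ 2 < 1 := by nlinarith
  obtain ⟨r, hr⟩ := hα.exists_reflection
  obtain ⟨s, hs⟩ := hβ.exists_reflection
  have hρα : cs.geomRep (r * s) α = (4 * c ^ 2 - 1) • α - (2 * c) • β := by
    simp only [geomRep_mul_apply, hs, hr, map_sub, map_smul, hα.titsForm_self, hc, hc', smul_eq_mul]
    module
  have hρβ : cs.geomRep (r * s) β = (2 * c) • α - β := by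
    simp only [geomRep_mul_apply, hs, hr, map_sub, map_smul, hβ.titsForm_self, hc, smul_eq_mul]
    module
  generalize r * s = ρ at hρα hρβ
  have he : 2 * c ^ 2 - 1 < 1 := by linarith
  obtain ⟨m, hm0, hm⟩ := hα.exists_pow_eq_self (w := ρ) he (by
    simp only [hρα, hρβ, map_sub, map_smul]; module)
  obtain ⟨n, hn0, hn⟩ := hβ.exists_pow_eq_self (w := ρ) he (by
    simp only [hρα, hρβ, map_sub, map_smul]; module)
  have hiter {v : B → ℝ} {k : ℕ} (hk : cs.geomRep (ρ ^ k) v = v) (l : ℕ) :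
      cs.geomRep (ρ ^ (k * l)) v = v := by
    induction l with
    | zero => simp
    | succ l ih => rw [mul_add, mul_one, pow_add, geomRep_mul_apply, hk, ih]
  have hmα := hiter hm n
  have hnβ := hiter hn m
  rw [mul_comm n m] at hnβ
  have hN : 0 < m * n := Nat.mul_pos hm0 hn0
  generalize m * n = N at hmα hnβ hN
  let F : (B → ℝ) →ₗ[ℝ] ℝ := ∑ k ∈ Finset.range N,
    (∑ i, LinearMap.proj i : (B → ℝ) →ₗ[ℝ] ℝ) ∘ₗ (cs.geomRep (ρ ^ k)).toLinearMap
  have hF (v : B → ℝ) : F v = ∑ k ∈ Finset.range N, ∑ i, cs.geomRep (ρ ^ k) v i := by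
    simp [F, LinearMap.sum_apply]
  have hFρ {v : B → ℝ} (hv : cs.geomRep (ρ ^ N) v = v) : F (cs.geomRep ρ v) = F v := by
    simp only [hF, ← geomRep_mul_apply, ← pow_succ]
    have := Finset.sum_range_succ' (fun k => ∑ i, cs.geomRep (ρ ^ k) v i) N
    rw [Finset.sum_range_succ] at this
    simpa [hv, -map_pow] using this.symm
  have h1 := hFρ hmα
  have h2 := hFρ hnβ
  rw [hρα, map_sub, map_smul, map_smul, smul_eq_mul, smul_eq_mul] at h1
  rw [hρβ, map_sub, map_smul, smul_eq_mul] at h2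
  have hβ' : F β = c * F α := by linarith
  have hα0 : F α = 0 := by
    rw [hβ'] at h1
    have : (1 - c ^ 2) * F α = 0 := by linarith
    exact (mul_eq_zero.1 this).resolve_left (by linarith)
  refine ⟨F, hα0, by rw [hβ', hα0, mul_zero], ?_⟩
  refine (Set.Finite.biUnion (Finset.range N).finite_toSet
    fun k _ => cs.finite_inversionSet (ρ ^ k)).subset ?_
  rintro v ⟨hv, hv0, hFv⟩
  rw [hF] at hFv
  obtain ⟨k, hk, hk'⟩ := Finset.exists_le_of_sum_le (s := Finset.range N)
    (f := fun k => ∑ i, cs.geomRep (ρ ^ k) v i) (g := fun _ => 0)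
    ⟨0, Finset.mem_range.2 hN⟩ (by simpa using hFv)
  refine Set.mem_biUnion hk ⟨hv, hv0, ?_⟩
  rw [← (hv.geomRep _).not_nonneg_iff]
  exact fun h0 => absurd ((hv.geomRep _).sum_pos h0) (not_lt.2 hk')

/-- A linear form negative on finitely many positive roots can be moved into the
fundamental chamber. -/
theorem exists_forall_nonneg (F : (B → ℝ) →ₗ[ℝ] ℝ)
    (hF : {v | cs.IsRoot v ∧ 0 ≤ v ∧ F v < 0}.Finite) :
    ∃ w, ∀ i, 0 ≤ F (cs.geomRep w (simpleRoot i)) := by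
  induction hn : {v | cs.IsRoot v ∧ 0 ≤ v ∧ F v < 0}.ncard using Nat.strong_induction_on
    generalizing F with
  | _ n ih =>
  by_cases hall : ∀ i, 0 ≤ F (simpleRoot i)
  · exact ⟨1, by simpa using hall⟩
  push Not at hall
  obtain ⟨i, hi⟩ := hall
  have hs : cs.geomRep (cs.simple i) (simpleRoot i) = -simpleRoot i := by
    rw [geomRep_simple_apply, titsForm_simpleRoot_self]; module
  have hss (v : B → ℝ) : cs.geomRep (cs.simple i) (cs.geomRep (cs.simple i) v) = v := by
    rw [← geomRep_mul_apply]; simp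
  let F' : (B → ℝ) →ₗ[ℝ] ℝ := F ∘ₗ (cs.geomRep (cs.simple i)).toLinearMap
  have hF' (v : B → ℝ) : F' v = F (cs.geomRep (cs.simple i) v) := rfl
  have hsub : cs.geomRep (cs.simple i) '' {v | cs.IsRoot v ∧ 0 ≤ v ∧ F' v < 0} ⊆
      {v | cs.IsRoot v ∧ 0 ≤ v ∧ F v < 0} \ {simpleRoot i} := by
    rintro _ ⟨v, ⟨hv, hv0, hFv⟩, rfl⟩
    refine ⟨⟨hv.geomRep _, ?_, hFv⟩, fun h => ?_⟩
    · by_contra h0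
      have := cs.eq_simpleRoot_of_mem_inversionSet_simple
        ⟨hv, hv0, (hv.geomRep _).not_nonneg_iff.1 h0⟩
      rw [hF', this, hs, map_neg] at hFv
      linarith
    · rw [Set.mem_singleton_iff] at h
      have : v = -simpleRoot i := by rw [← hss v, h, hs]
      refine (hv.not_nonneg_iff.2 ?_) hv0
      rw [this]
      exact neg_nonpos.2 (simpleRoot_nonneg i)
  have hfin' := (hF.sdiff (t := {simpleRoot i})).subset hsub
  have hcard : {v | cs.IsRoot v ∧ 0 ≤ v ∧ F' v < 0}.ncard < n := by
    rw [← hn, ← Set.ncard_image_of_injective _ (cs.geomRep (cs.simple i)).injective]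
    exact (Set.ncard_le_ncard hsub hF.sdiff).trans_lt
      (Set.ncard_sdiff_singleton_lt_of_mem ⟨cs.isRoot_simpleRoot i, simpleRoot_nonneg i, hi⟩ hF)
  obtain ⟨w, hw⟩ := ih _ hcard F'
    (Set.Finite.of_finite_image hfin' (cs.geomRep (cs.simple i)).injective.injOn) rfl
  exact ⟨cs.simple i * w, fun j => by rw [geomRep_mul_apply]; exact hw j⟩

theorem finite_titsForm_values :
    {c : ℝ | |c| < 1 ∧ ∃ α β, cs.IsRoot α ∧ cs.IsRoot β ∧ M.titsForm α β = c}.Finite := by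
  let Φ : Set B → Set (B → ℝ) := fun J => {v | cs.IsRoot v ∧ ∀ i ∉ J, v i = 0}
  refine (Set.Finite.biUnion (Set.toFinite {J : Set B | (Φ J).Finite})
    (t := fun J => Set.image2 (fun α β => M.titsForm α β) (Φ J) (Φ J))
    fun J (hJ : (Φ J).Finite) => hJ.image2 _ hJ).subset ?_
  rintro c ⟨hc, α, β, hα, hβ, rfl⟩
  obtain ⟨F, hFα, hFβ, hfin⟩ := hα.exists_linearMap hβ hc
  obtain ⟨w, hw⟩ := exists_forall_nonneg (cs := cs) F
    (hfin.subset fun v ⟨hv, hv0, hF⟩ => ⟨hv, hv0, hF.le⟩)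
  let J : Set B := {i | F (cs.geomRep w (simpleRoot i)) = 0}
  have hsum (v : B → ℝ) : F (cs.geomRep w v) = ∑ i, v i * F (cs.geomRep w (simpleRoot i)) := by
    conv_lhs => rw [show v = ∑ i, v i • simpleRoot i by
      simpa [simpleRoot] using (pi_eq_sum_univ' v)]
    simp only [map_sum, map_smul, smul_eq_mul]
  have hJ {v : B → ℝ} (hv0 : 0 ≤ v) (hF : F (cs.geomRep w v) = 0) (i : B) (hi : i ∉ J) :
      v i = 0 := by
    rw [hsum] at hF
    have := (Finset.sum_eq_zero_iff_of_nonneg fun i _ => mul_nonneg (hv0 i) (hw i)).1 hF i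
      (Finset.mem_univ i)
    exact (mul_eq_zero.1 this).resolve_right hi
  have hmem {v : B → ℝ} (hv : cs.IsRoot v) (hF : F v = 0) : cs.geomRep w⁻¹ v ∈ Φ J := by
    refine ⟨hv.geomRep _, fun i hi => ?_⟩
    rcases (hv.geomRep w⁻¹).nonneg_or_nonpos with h | h
    · exact hJ h (by rw [geomRep_self_apply_inv, hF]) i hi
    · simpa using hJ (neg_nonneg.2 h) (by
        rw [map_neg, geomRep_self_apply_inv, map_neg, hF, neg_zero]) i hi
  refine Set.mem_biUnion (x := J) ?_ ⟨_, hmem hα hFα, _, hmem hβ hFβ, by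
    simp only [titsForm_geomRep]⟩
  refine ((hfin.union hfin.neg).image (cs.geomRep w⁻¹)).subset ?_
  rintro v ⟨hv, hvJ⟩
  have hF0 : F (cs.geomRep w v) = 0 := by
    rw [hsum]
    refine Finset.sum_eq_zero fun i _ => ?_
    by_cases hi : i ∈ J
    · rw [show F (cs.geomRep w (simpleRoot i)) = 0 from hi, mul_zero]
    · rw [hvJ i hi, zero_mul]
  refine ⟨cs.geomRep w v, ?_, cs.geomRep_inv_apply_self w v⟩
  rcases (hv.geomRep w).nonneg_or_nonpos with h | h
  · exact Or.inl ⟨hv.geomRep _, h, hF0.le⟩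
  · exact Or.inr ⟨(hv.geomRep _).neg, neg_nonneg.2 h, by rw [map_neg, hF0, neg_zero]⟩

end CoxeterSystem

namespace CoxeterSystem

open CoxeterMatrix

variable {B W : Type*} [Fintype B] [DecidableEq B] [Group W] {M : CoxeterMatrix B}
  {cs : CoxeterSystem M W}

theorem NoFacingTriple.one_le_titsForm_trans (hN : cs.NoFacingTriple) {α β γ : B → ℝ}
    (hα : cs.IsRoot α) (hβ : cs.IsRoot β) (hγ : cs.IsRoot γ) (h : 1 ≤ M.titsForm α β)
    (h' : 1 ≤ M.titsForm β γ) : 1 ≤ M.titsForm α γ := by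
  refine hN.one_le_titsForm_of_facing hα hβ.neg hγ ?_ ?_
  · rw [map_neg]; linarith
  · rw [map_neg, M.titsForm_comm]; linarith

/-- The position of a vector with respect to the simple roots, with pairings truncated
to `[-1, 1]`. -/
noncomputable def profile (M : CoxeterMatrix B) (v : B → ℝ) : B → ℝ :=
  fun i => max (-1) (min 1 (M.titsForm v (simpleRoot i)))

theorem finite_profile_image : (profile M '' {v | cs.IsRoot v}).Finite := by
  refine (Set.Finite.pi' (t := fun _ : B => insert (-1) (insert 1 {c : ℝ | |c| < 1 ∧
    ∃ α β, cs.IsRoot α ∧ cs.IsRoot β ∧ M.titsForm α β = c})) fun _ =>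
      (finite_titsForm_values.insert 1).insert (-1)).subset ?_
  rintro _ ⟨v, hv, rfl⟩ i
  simp only [profile]
  rcases le_or_gt (M.titsForm v (simpleRoot i)) (-1) with h | h
  · left
    rw [max_eq_left]
    exact (min_le_right _ _).trans h
  right
  rcases le_or_gt 1 (M.titsForm v (simpleRoot i)) with h' | h'
  · left
    rw [min_eq_left h', max_eq_right (by norm_num)]
  · right
    rw [min_eq_right h'.le, max_eq_right h.le]
    exact ⟨abs_lt.2 ⟨h, h'⟩, _, _, hv, cs.isRoot_simpleRoot i, rfl⟩

theorem NoFacingTriple.one_le_titsForm_of_profile_eq (hN : cs.NoFacingTriple) {v v' : B → ℝ}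
    (hv : cs.IsRoot v) (hv' : cs.IsRoot v') (h : profile M v = profile M v') :
    1 ≤ M.titsForm v v' := by
  have hi (i : B) : max (-1) (min 1 (M.titsForm v (simpleRoot i))) =
    max (-1) (min 1 (M.titsForm v' (simpleRoot i))) := congrFun h i
  by_cases h1 : ∃ i, 1 ≤ M.titsForm v (simpleRoot i)
  · obtain ⟨i, h1⟩ := h1
    refine hN.one_le_titsForm_trans hv (cs.isRoot_simpleRoot i) hv' h1 ?_
    rw [M.titsForm_comm]
    by_contra! h2
    have := hi i
    rw [min_eq_left h1, max_eq_right (by norm_num), min_eq_right h2.le] at this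
    exact absurd this.symm (max_lt (by norm_num) h2).ne
  by_cases h2 : ∃ i, M.titsForm v (simpleRoot i) ≤ -1
  · obtain ⟨i, h2⟩ := h2
    refine hN.one_le_titsForm_of_facing hv (cs.isRoot_simpleRoot i) hv' h2 ?_
    by_contra! h3
    have := hi i
    rw [max_eq_left ((min_le_right _ _).trans h2)] at this
    exact absurd this (lt_max_of_lt_right (lt_min (by norm_num) h3)).ne
  push Not at h1 h2
  have heq (i : B) : M.titsForm v (simpleRoot i) = M.titsForm v' (simpleRoot i) := by
    have := hi i
    rw [min_eq_right (h1 i).le, max_eq_right (h2 i).le] at this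
    have h3 := h1 i
    have h4 := h2 i
    rw [this] at h3 h4 ⊢
    have h5 := (min_lt_iff.1 ((max_lt_iff.1 h3).2)).resolve_left (lt_irrefl 1)
    have h6 := (lt_min_iff.1 ((lt_max_iff.1 h4).resolve_left (lt_irrefl _))).2
    rw [min_eq_right h5.le, max_eq_right h6.le]
  have hsum (u : B → ℝ) : M.titsForm u v' = ∑ i, v' i * M.titsForm u (simpleRoot i) := by
    conv_lhs => rw [show v' = ∑ i, v' i • simpleRoot i by
      simpa [simpleRoot] using (pi_eq_sum_univ' v')]
    simp only [map_sum, map_smul, smul_eq_mul]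
  rw [hsum, Finset.sum_congr rfl fun i _ => by rw [heq i], ← hsum, hv'.titsForm_self]

/-- The elements preserving every parallelism class of roots. -/
def NoFacingTriple.parallelSubgroup (hN : cs.NoFacingTriple) : Subgroup W where
  carrier := {w | ∀ v, cs.IsRoot v → 1 ≤ M.titsForm v (cs.geomRep w v)}
  one_mem' v hv := by simp [hv.titsForm_self]
  mul_mem' {w w'} hw hw' v hv := by
    rw [geomRep_mul_apply]
    exact hN.one_le_titsForm_trans hv (hv.geomRep w') ((hv.geomRep w').geomRep w) (hw' v hv)
      (hw _ (hv.geomRep w'))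
  inv_mem' {w} hw v hv := by
    rw [← cs.titsForm_geomRep w, geomRep_self_apply_inv, M.titsForm_comm]
    exact hw v hv

theorem NoFacingTriple.finiteIndex_parallelSubgroup (hN : cs.NoFacingTriple) :
    hN.parallelSubgroup.FiniteIndex := by
  let P := profile M '' {v | cs.IsRoot v}
  have : Finite P := finite_profile_image.to_subtype
  choose rep hrep hprof using fun p : P => p.2
  let Ψ : W → P → P := fun w p =>
    ⟨profile M (cs.geomRep w (rep p)), _, IsRoot.geomRep (hrep p) w, rfl⟩
  have hΨ {w w' : W} (h : Ψ w = Ψ w') : w⁻¹ * w' ∈ hN.parallelSubgroup := by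
    intro v hv
    have hpv : profile M v ∈ P := ⟨v, hv, rfl⟩
    have hr : cs.IsRoot (rep ⟨_, hpv⟩) := hrep _
    have h1 := hN.one_le_titsForm_of_profile_eq hv hr (hprof ⟨_, hpv⟩).symm
    have h2 := hN.one_le_titsForm_of_profile_eq (hr.geomRep w) (hr.geomRep w')
      (congrArg Subtype.val (congrFun h ⟨_, hpv⟩))
    rw [← cs.titsForm_geomRep w, ← geomRep_mul_apply, mul_inv_cancel_left]
    refine hN.one_le_titsForm_trans (hv.geomRep _) (hr.geomRep _) (hv.geomRep _)
      (by rwa [titsForm_geomRep]) ?_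
    refine hN.one_le_titsForm_trans (hr.geomRep _) (hr.geomRep _) (hv.geomRep _) h2 ?_
    rwa [titsForm_geomRep, M.titsForm_comm]
  have hinj : Function.Injective fun q : W ⧸ hN.parallelSubgroup => Ψ q.out := by
    intro q q' h
    rw [← Quotient.out_eq' q, ← Quotient.out_eq' q']
    exact QuotientGroup.eq.2 (hΨ h)
  have := Finite.of_injective _ hinj
  exact Subgroup.finiteIndex_of_finite_quotient

open Classical in
theorem NoFacingTriple.parallelSubgroup_comm (hN : cs.NoFacingTriple) {k l : W}
    (hk : k ∈ hN.parallelSubgroup) (hl : l ∈ hN.parallelSubgroup) : k * l = l * k := by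
  let ind : (B → ℝ) → ℤ := fun v => if 0 ≤ v then 1 else 0
  let t : (B → ℝ) → W → (B → ℝ) → ℤ := fun γ w δ =>
    if cs.IsRoot δ ∧ 1 ≤ M.titsForm γ δ then ind δ - ind (cs.geomRep w δ) else 0
  have hfin (γ : B → ℝ) (w : W) : (Function.support (t γ w)).Finite := by
    refine ((cs.finite_inversionSet w).union (cs.finite_inversionSet w).neg).subset ?_
    intro δ hδ
    by_cases hr : cs.IsRoot δ ∧ 1 ≤ M.titsForm γ δ
    swap
    · exact absurd (if_neg hr) hδ
    have hδ' : ind δ - ind (cs.geomRep w δ) ≠ 0 := by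
      simpa only [t, Function.mem_support, if_pos hr] using hδ
    by_cases h0 : 0 ≤ δ <;> by_cases h1 : 0 ≤ cs.geomRep w δ
    · simp [ind, h0, h1] at hδ'
    · exact Or.inl ⟨hr.1, h0, (hr.1.geomRep w).not_nonneg_iff.1 h1⟩
    · exact Or.inr ⟨hr.1.neg, neg_nonneg.2 (hr.1.not_nonneg_iff.1 h0), by
        rw [map_neg]; exact neg_nonpos.2 h1⟩
    · simp [ind, h0, h1] at hδ'
  have hadd {γ : B → ℝ} (hγ : cs.IsRoot γ) (a : W) {b : W} (hb : b ∈ hN.parallelSubgroup) :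
      ∑ᶠ δ, t γ (a * b) δ = ∑ᶠ δ, t γ a δ + ∑ᶠ δ, t γ b δ := by
    have hcomp := finsum_comp_equiv (f := t γ a) (cs.geomRep b).toEquiv
    have hfin' : (Function.support fun δ => t γ a ((cs.geomRep b).toEquiv δ)).Finite :=
      (hfin γ a).preimage (cs.geomRep b).injective.injOn
    rw [← hcomp, ← finsum_add_distrib hfin' (hfin γ b)]
    refine finsum_congr fun δ => ?_
    have hiff : (cs.IsRoot (cs.geomRep b δ) ∧ 1 ≤ M.titsForm γ (cs.geomRep b δ)) ↔
        (cs.IsRoot δ ∧ 1 ≤ M.titsForm γ δ) := by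
      constructor
      · rintro ⟨h, h1⟩
        have hδ : cs.IsRoot δ := by simpa using h.geomRep b⁻¹
        refine ⟨hδ, hN.one_le_titsForm_trans hγ h hδ h1 ?_⟩
        rw [M.titsForm_comm]
        exact hb δ hδ
      · rintro ⟨h, h1⟩
        exact ⟨h.geomRep b, hN.one_le_titsForm_trans hγ h (h.geomRep b) h1 (hb δ h)⟩
    simp only [t, LinearEquiv.coe_toEquiv, hiff, geomRep_mul_apply]
    split_ifs <;> ring
  have hg : (l * k)⁻¹ * (k * l) ∈ hN.parallelSubgroup :=
    mul_mem (inv_mem (mul_mem hl hk)) (mul_mem hk hl)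
  have hzero {γ : B → ℝ} (hγ : cs.IsRoot γ) : ∑ᶠ δ, t γ ((l * k)⁻¹ * (k * l)) δ = 0 := by
    have h1 := hadd hγ (l * k) hg
    rw [mul_inv_cancel_left, hadd hγ k hl, hadd hγ l hk] at h1
    linarith
  have hempty : cs.inversionSet ((l * k)⁻¹ * (k * l)) = ∅ := by
    generalize (l * k)⁻¹ * (k * l) = g at hzero
    refine Set.eq_empty_iff_forall_notMem.2 fun γ ⟨hγ, h0, h1⟩ => ?_
    have hnn (δ : B → ℝ) : 0 ≤ t γ g δ := by
      by_cases hr : cs.IsRoot δ ∧ 1 ≤ M.titsForm γ δ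
      swap
      · simp [t, hr]
      simp only [t, if_pos hr]
      by_cases h2 : 0 ≤ δ
      · simp only [ind, if_pos h2]; split_ifs <;> norm_num
      by_cases h3 : 0 ≤ cs.geomRep g δ
      · refine (hγ.not_both_inverted hr.1.neg ?_ h0
          (neg_nonneg.2 (hr.1.not_nonneg_iff.1 h2)) g h1 ?_).elim
        · rw [map_neg]; linarith [hr.2]
        · rw [map_neg]; exact neg_nonpos.2 h3
      · simp [ind, h2, h3]
    have h2 := single_le_finsum γ (hfin γ g) hnn
    rw [hzero hγ] at h2
    have h3 := ((hγ.geomRep g).not_nonneg_iff.2 h1)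
    simp [t, ind, hγ, hγ.titsForm_self, h0, h3] at h2
  exact (inv_mul_eq_one.1 (cs.eq_one_of_inversionSet_eq_empty hempty)).symm

end CoxeterSystem

theorem summable_pow_sum {ι : Type*} [Fintype ι] {x : ℝ} (hx0 : 0 ≤ x) (hx1 : x < 1) :
    Summable fun f : ι → ℕ => x ^ ∑ i, f i := by
  classical
  refine summable_of_sum_le (c := ((1 - x)⁻¹) ^ Fintype.card ι) (fun f => pow_nonneg hx0 _)
    fun u => ?_
  calc ∑ f ∈ u, x ^ ∑ i, f i
      ≤ ∑ f ∈ Fintype.piFinset fun i => u.image fun f => f i, x ^ ∑ i, f i := by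
        refine Finset.sum_le_sum_of_subset_of_nonneg (fun f hf => ?_) fun f _ _ =>
          pow_nonneg hx0 _
        exact Fintype.mem_piFinset.2 fun i => Finset.mem_image_of_mem _ hf
    _ = ∏ i, ∑ n ∈ u.image fun f => f i, x ^ n := by
        rw [Finset.prod_univ_sum]
        exact Finset.sum_congr rfl fun f _ => (Finset.prod_pow_eq_pow_sum _ _ _).symm
    _ ≤ ∏ _i : ι, (1 - x)⁻¹ := by
        refine Finset.prod_le_prod (fun i _ => Finset.sum_nonneg fun n _ => pow_nonneg hx0 n)
          fun i _ => ?_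
        rw [← tsum_geometric_of_lt_one hx0 hx1]
        exact (summable_geometric_of_lt_one hx0 hx1).sum_le_tsum _ fun n _ => pow_nonneg hx0 n
    _ = _ := by rw [Finset.prod_const, Finset.card_univ]

namespace CoxeterSystem

/-- A virtually abelian Coxeter group of finite rank has subexponential growth. -/
theorem summable_pow_length_of_finiteIndex {B W : Type*} [Finite B] [Group W]
    {M : CoxeterMatrix B} (cs : CoxeterSystem M W) (H : Subgroup W) [H.FiniteIndex]
    (hH : ∀ a ∈ H, ∀ b ∈ H, a * b = b * a) {x : ℝ} (hx0 : 0 ≤ x) (hx1 : x < 1) :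
    Summable fun w : W => x ^ cs.length w := by
  classical
  have := Fintype.ofFinite B
  have := Fintype.ofFinite (W ⧸ H)
  let _ : CommGroup H :=
    { (inferInstance : Group H) with mul_comm := fun a b => Subtype.ext (hH a a.2 b b.2) }
  have hmem (p : B × (W ⧸ H)) : (cs.simple p.1 • p.2).out⁻¹ * (cs.simple p.1 * p.2.out) ∈ H := by
    rw [← QuotientGroup.eq, QuotientGroup.out_eq', ← smul_eq_mul, ← MulAction.Quotient.smul_coe,
      QuotientGroup.out_eq']
  let h : B × (W ⧸ H) → H := fun p => ⟨_, hmem p⟩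
  have hword (ω : List B) : ∃ f : B × (W ⧸ H) → ℕ, ∑ p, f p = ω.length ∧
      cs.wordProd ω = (cs.wordProd ω : W ⧸ H).out * ((∏ p, h p ^ f p : H) : W) *
        ((1 : W) : W ⧸ H).out⁻¹ := by
    induction ω with
    | nil => exact ⟨0, by simp, by simp⟩
    | cons i ω ih =>
      obtain ⟨f, hf, hω⟩ := ih
      let p : B × (W ⧸ H) := (i, (cs.wordProd ω : W ⧸ H))
      refine ⟨f + Pi.single p 1, by simp [Finset.sum_add_distrib, hf], ?_⟩
      have hprod : ∏ q, h q ^ (f + Pi.single p 1 : B × (W ⧸ H) → ℕ) q = h p * ∏ q, h q ^ f q := by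
        simp only [Pi.add_apply, pow_add, Finset.prod_mul_distrib]
        rw [mul_comm]
        congr 1
        simp [Pi.single_apply, pow_ite]
      have hp : cs.simple i * (cs.wordProd ω : W ⧸ H).out =
          ((cs.simple i * cs.wordProd ω : W) : W ⧸ H).out * (h p : W) :=
        (mul_inv_cancel_left _ _).symm
      rw [hprod, Subgroup.coe_mul, cs.wordProd_cons, ← mul_assoc, ← hp]
      conv_lhs => rw [hω]
      simp only [mul_assoc]
  choose f hf hω using hword
  choose ω hred hprod using cs.exists_isReduced
  have hsum : Summable fun p : (W ⧸ H) × (B × (W ⧸ H) → ℕ) => x ^ ∑ i, p.2 i :=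
    (summable_prod_of_nonneg fun p => pow_nonneg hx0 _).2
      ⟨fun _ => summable_pow_sum hx0 hx1, Summable.of_finite⟩
  have hinj : Function.Injective fun w : W => ((w : W ⧸ H), f (ω w)) := by
    intro w w' heq
    rw [Prod.mk.injEq] at heq
    have h1 := hω (ω w)
    have h2 := hω (ω w')
    rw [← hprod] at h1 h2
    rw [h1, h2, heq.1, heq.2]
  refine (hsum.comp_injective hinj).congr fun w => ?_
  have hw : cs.length (cs.wordProd (ω w)) = (ω w).length := hred w
  rw [Function.comp_apply, hf, ← hw, ← hprod]

end CoxeterSystem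

/-- **Virtually abelian ⟺ growth series has radius of convergence 1.**
Let `(W, S)` be a Coxeter system with `S` finite and `W` infinite.  Then `W` is virtually
abelian if and only if for every real `x` with `0 < x < 1` the family `(x^{ℓ w})_{w ∈ W}` is
summable (equivalently: the radius of convergence of the growth series `Σ_w t^{ℓ w}`
equals `1`). -/
theorem virtually_abelian_iff_growth_radius_one {B : Type*} [Fintype B] {W : Type*} [Group W]
    [Infinite W] {M : CoxeterMatrix B} (cs : CoxeterSystem M W) :
    (∃ H : Subgroup W, H.FiniteIndex ∧ ∀ a ∈ H, ∀ b ∈ H, a * b = b * a) ↔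
      ∀ x : ℝ, 0 < x → x < 1 → Summable (fun w : W => x ^ cs.length w) := by
  classical
  constructor
  · rintro ⟨H, hfin, hcomm⟩ x hx0 hx1
    exact cs.summable_pow_length_of_finiteIndex H hcomm hx0.le hx1
  · intro h
    have hN : cs.NoFacingTriple := by
      intro α β γ hα hβ hγ hαβ hαγ hβγ
      obtain ⟨x, hx0, hx1, hx⟩ := CoxeterSystem.exists_not_summable_of_facing (cs := cs)
        (α := ![α, β, γ])
        (by intro i; fin_cases i <;> assumption)
        (by
          intro i j hij
          fin_cases i <;> fin_cases j <;>
            first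
              | exact absurd rfl hij
              | assumption
              | (rw [M.titsForm_comm]; assumption))
      exact hx (h x hx0 hx1)
    exact ⟨hN.parallelSubgroup, hN.finiteIndex_parallelSubgroup,
      fun a ha b hb => hN.parallelSubgroup_comm ha hb⟩
end

section
/- Let (W,S) be a right-angled Coxeter system with S finite (i.e., for distinct s, s' ∈ S the order of ss' is 2 or ∞), let 𝒮 be the set of spherical subsets of S, and let n := max{Card T : T ∈ 𝒮} (so the nerve L of (W,S) has dimension n−1). Then in ℤ[[t]]: (Σ_{w∈W} t^{ℓ(w)}) · (Σ_{T∈𝒮} (−t)^{Card T} (1+t)^{n − Card T}) = (1+t)^n. (Equivalently, 1/W(t) = h_L(−t)/(1+t)^n, where h_L is the h-polynomial of L.) -/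
namespace CoxeterSystem

variable {B W : Type*} [Group W] {M : CoxeterMatrix B} (cs : CoxeterSystem M W)

/-- A Coxeter system is right-angled if the product of any two distinct simple reflections has
order `2` or `∞`. -/
def IsRightAngled : Prop :=
  ∀ i j : B, i ≠ j →
    orderOf (cs.simple i * cs.simple j) = 2 ∨ orderOf (cs.simple i * cs.simple j) = 0

variable {cs}

theorem commute_simple_of_orderOf_eq_two {i j : B}
    (h : orderOf (cs.simple i * cs.simple j) = 2) : Commute (cs.simple i) (cs.simple j) := by
  have h2 : (cs.simple i * cs.simple j) ^ 2 = 1 := h ▸ pow_orderOf_eq_one _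
  rw [pow_two, mul_eq_one_iff_eq_inv] at h2
  simpa [Commute, SemiconjBy] using h2

theorem IsRightAngled.simple_injective (h : cs.IsRightAngled) :
    Function.Injective cs.simple := by
  intro i j hij
  by_contra hne
  rcases h i j hne with h | h <;> simp [hij] at h

theorem IsRightAngled.orderOf_eq_zero (h : cs.IsRightAngled) {i j : B}
    (hij : ¬ Commute (cs.simple i) (cs.simple j)) :
    orderOf (cs.simple i * cs.simple j) = 0 := by
  have hne : i ≠ j := by rintro rfl; exact hij (Commute.refl _)
  exact (h i j hne).resolve_left fun h2 => hij (commute_simple_of_orderOf_eq_two h2)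

/-- In a right-angled Coxeter system, a map on the generators extends to the group as soon as it
respects the involutions and the commutations. -/
theorem IsRightAngled.isLiftable (h : cs.IsRightAngled) {G : Type*} [Monoid G] {f : B → G}
    (hsq : ∀ i, f i * f i = 1)
    (hcomm : ∀ i j, Commute (cs.simple i) (cs.simple j) → Commute (f i) (f j)) :
    M.IsLiftable f := by
  intro i j
  rcases eq_or_ne i j with rfl | hij
  · simp [hsq]
  have hdvd : orderOf (cs.simple i * cs.simple j) ∣ M i j :=
    orderOf_dvd_of_pow_eq_one (cs.simple_mul_simple_pow i j)
  rcases h i j hij with h2 | h0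
  · obtain ⟨k, hk⟩ := h2 ▸ hdvd
    rw [hk, pow_mul, (hcomm i j (commute_simple_of_orderOf_eq_two h2)).mul_pow, pow_two, pow_two,
      hsq, hsq, one_mul, one_pow]
  · rw [h0, zero_dvd_iff] at hdvd
    rw [hdvd, pow_zero]

variable (cs)

theorem simple_mul_zpow (i j : B) (m : ℤ) :
    cs.simple i * (cs.simple i * cs.simple j) ^ m =
      (cs.simple i * cs.simple j) ^ (-m) * cs.simple i := by
  have hs : SemiconjBy (cs.simple i) (cs.simple i * cs.simple j)
      (cs.simple i * cs.simple j)⁻¹ := by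
    simp [SemiconjBy, mul_assoc]
  rw [zpow_neg, ← inv_zpow]
  exact (hs.zpow_right m).eq

theorem exists_zpow_of_mem_closure_pair {i j : B} {u : W}
    (hu : u ∈ Subgroup.closure {cs.simple i, cs.simple j}) :
    ∃ m : ℤ, u = (cs.simple i * cs.simple j) ^ m ∨
      u = cs.simple i * (cs.simple i * cs.simple j) ^ m := by
  have step : ∀ y ∈ ({cs.simple i, cs.simple j} : Set W), ∀ u : W,
      (∃ m : ℤ, u = (cs.simple i * cs.simple j) ^ m ∨
        u = cs.simple i * (cs.simple i * cs.simple j) ^ m) →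
      ∃ m : ℤ, y * u = (cs.simple i * cs.simple j) ^ m ∨
        y * u = cs.simple i * (cs.simple i * cs.simple j) ^ m := by
    rintro y (rfl | rfl) u ⟨m, rfl | rfl⟩
    · exact ⟨m, Or.inr rfl⟩
    · exact ⟨m, Or.inl (cs.simple_mul_simple_cancel_left i)⟩
    · refine ⟨1 + m, Or.inr ?_⟩
      rw [zpow_add, zpow_one, ← mul_assoc, ← mul_assoc, simple_mul_simple_self, one_mul]
    · refine ⟨-1 + m, Or.inl ?_⟩
      rw [zpow_add, zpow_neg_one, ← mul_assoc]
      simp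
  induction hu using Subgroup.closure_induction_left with
  | one => exact ⟨0, Or.inl (by simp)⟩
  | mul_left y hy u _ ih => exact step y hy u ih
  | inv_mul_cancel y hy u _ ih =>
    have : y⁻¹ = y := by rcases hy with rfl | rfl <;> simp
    rw [this]
    exact step y hy u ih

theorem simple_eq_zpow_neg_one_mul (i j : B) :
    cs.simple j = (cs.simple i * cs.simple j) ^ (-1 : ℤ) * cs.simple i := by
  simp

theorem conj_zpow_mul_simple (i j : B) (m k : ℤ) :
    (cs.simple i * cs.simple j) ^ m * ((cs.simple i * cs.simple j) ^ k * cs.simple i) *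
      ((cs.simple i * cs.simple j) ^ m)⁻¹ =
      (cs.simple i * cs.simple j) ^ (k + 2 * m) * cs.simple i := by
  rw [← zpow_neg, mul_assoc, mul_assoc, simple_mul_zpow, neg_neg, ← mul_assoc, ← mul_assoc,
    ← zpow_add, ← zpow_add]
  congr 2
  ring

open scoped Classical in
/-- The action of the simple reflection `s i` on pairs of a group element and a sign. -/
noncomputable def signedConj (i : B) : Function.End (W × ZMod 2) := fun p =>
  (cs.simple i * p.1 * cs.simple i, p.2 + if p.1 = cs.simple i then 1 else 0)

variable {cs}

theorem signedConj_mul_self (i : B) : cs.signedConj i * cs.signedConj i = 1 := by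
  classical
  funext ⟨r, e⟩
  have h : cs.simple i * r * cs.simple i = cs.simple i ↔ r = cs.simple i := by
    constructor
    · intro h
      simpa [mul_assoc] using congrArg (fun z => cs.simple i * z * cs.simple i) h
    · rintro rfl; simp
  change (_, _) = (r, e)
  simp only [signedConj, h, Prod.mk.injEq]
  refine ⟨by simp [mul_assoc], ?_⟩
  rw [add_assoc, CharTwo.add_self_eq_zero, add_zero]

theorem commute_signedConj {i j : B} (h : Commute (cs.simple i) (cs.simple j)) :
    Commute (cs.signedConj i) (cs.signedConj j) := by
  classical
  have key : ∀ {i j : B}, Commute (cs.simple i) (cs.simple j) → ∀ r : W,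
      cs.simple j * r * cs.simple j = cs.simple i ↔ r = cs.simple i := by
    intro i j h r
    constructor
    · intro hr
      have := congrArg (fun z => cs.simple j * z * cs.simple j) hr
      simpa [mul_assoc, h.eq] using this
    · rintro rfl
      rw [mul_assoc, h.eq, simple_mul_simple_cancel_left]
  funext ⟨r, e⟩
  change (_, _) = (_, _)
  simp only [signedConj, key h, key h.symm, Prod.mk.injEq]
  refine ⟨?_, by ring⟩
  have hc := h.eq
  calc cs.simple i * (cs.simple j * r * cs.simple j) * cs.simple i
      = (cs.simple i * cs.simple j) * r * (cs.simple j * cs.simple i) := by group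
    _ = (cs.simple j * cs.simple i) * r * (cs.simple i * cs.simple j) := by rw [hc]
    _ = _ := by group

namespace IsRightAngled

variable (h : cs.IsRightAngled)

/-- The action of `W` on pairs of a group element and a sign extending `signedConj`. -/
noncomputable def signedConjHom : W →* Function.End (W × ZMod 2) :=
  cs.lift ⟨cs.signedConj, h.isLiftable signedConj_mul_self fun _ _ => commute_signedConj⟩

@[simp] theorem signedConjHom_simple (i : B) :
    h.signedConjHom (cs.simple i) = cs.signedConj i :=
  cs.lift_apply_simple _ i

/-- The sign change of `(r, 0)` under the action of `w`; for a simple reflection `r` it is nonzero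
exactly when `r` is a right descent of `w`, see `isRightDescent_iff_inversionParity`. -/
noncomputable def inversionParity (w r : W) : ZMod 2 :=
  (h.signedConjHom w (r, 0)).2

theorem signedConjHom_apply (w r : W) (e : ZMod 2) :
    h.signedConjHom w (r, e) = (w * r * w⁻¹, e + h.inversionParity w r) := by
  unfold inversionParity
  induction w using cs.simple_induction_left generalizing r e with
  | one =>
    rw [map_one]
    change (r, e) = (_, e + 0)
    simp
  | mul_simple_left w i ih =>
    rw [map_mul]
    change h.signedConjHom _ (h.signedConjHom _ _) =
      (_, e + (h.signedConjHom _ (h.signedConjHom _ _)).2)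
    rw [ih r e, ih r 0, signedConjHom_simple]
    simp [signedConj, mul_assoc, add_assoc]

theorem inversionParity_mul (w v r : W) :
    h.inversionParity (w * v) r = h.inversionParity v r + h.inversionParity w (v * r * v⁻¹) := by
  conv_lhs => unfold inversionParity
  rw [map_mul]
  change (h.signedConjHom _ (h.signedConjHom _ _)).2 = _
  rw [signedConjHom_apply, signedConjHom_apply]
  simp

@[simp] theorem inversionParity_one (r : W) : h.inversionParity 1 r = 0 := by
  unfold inversionParity
  rw [map_one]
  rfl

open scoped Classical in
theorem inversionParity_simple (i : B) (r : W) :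
    h.inversionParity (cs.simple i) r = if r = cs.simple i then 1 else 0 := by
  unfold inversionParity
  rw [signedConjHom_simple]
  simp [signedConj]

theorem mem_rightInvSeq_of_inversionParity_ne_zero (ω : List B) (r : W)
    (hr : h.inversionParity (cs.wordProd ω) r ≠ 0) : r ∈ cs.rightInvSeq ω := by
  classical
  induction ω with
  | nil => simp at hr
  | cons i ω ih =>
    rw [rightInvSeq, List.mem_cons]
    by_cases hω : h.inversionParity (cs.wordProd ω) r = 0
    · left
      rw [wordProd_cons, inversionParity_mul, hω, inversionParity_simple, zero_add] at hr
      have := of_not_not fun hne => hr (if_neg hne)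
      rw [← this]
      group
    · exact Or.inr (ih hω)

theorem length_mul_lt_of_inversionParity_ne_zero {w r : W} (hr : h.inversionParity w r ≠ 0) :
    cs.length (w * r) < cs.length w := by
  obtain ⟨ω, hω, rfl⟩ := cs.exists_isReduced w
  exact (cs.isRightInversion_of_mem_rightInvSeq hω
    (h.mem_rightInvSeq_of_inversionParity_ne_zero ω r hr)).2

theorem isRightDescent_iff_inversionParity {w : W} {i : B} :
    cs.IsRightDescent w i ↔ h.inversionParity w (cs.simple i) ≠ 0 := by
  classical
  refine ⟨fun hd hz => ?_, fun hne => h.length_mul_lt_of_inversionParity_ne_zero hne⟩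
  have hne : h.inversionParity (w * cs.simple i) (cs.simple i) ≠ 0 := by
    simp [inversionParity_mul, inversionParity_simple, hz]
  have := h.length_mul_lt_of_inversionParity_ne_zero hne
  rw [simple_mul_simple_cancel_right] at this
  exact lt_asymm hd this

include h in
theorem isRightDescent_mul_simple_iff {i j : B} (hij : i ≠ j)
    (hc : Commute (cs.simple i) (cs.simple j)) (w : W) :
    cs.IsRightDescent (w * cs.simple j) i ↔ cs.IsRightDescent w i := by
  classical
  rw [h.isRightDescent_iff_inversionParity, h.isRightDescent_iff_inversionParity,
    inversionParity_mul, inversionParity_simple, if_neg (h.simple_injective.ne hij), zero_add,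
    ← hc.eq, mul_inv_cancel_right]

section Dihedral

variable {i j : B}

include h in
theorem zpow_mul_simple_inj (hij : ¬ Commute (cs.simple i) (cs.simple j)) {a b : ℤ} :
    (cs.simple i * cs.simple j) ^ a * cs.simple i =
      (cs.simple i * cs.simple j) ^ b * cs.simple i ↔ a = b := by
  rw [mul_left_inj]
  exact (injective_zpow_iff_not_isOfFinOrder.2
    (orderOf_eq_zero_iff.1 (h.orderOf_eq_zero hij))).eq_iff

theorem inversionParity_simple_left (hij : ¬ Commute (cs.simple i) (cs.simple j)) (k : ℤ) :
    h.inversionParity (cs.simple i) ((cs.simple i * cs.simple j) ^ k * cs.simple i) =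
      if k = 0 then 1 else 0 := by
  classical
  have := h.zpow_mul_simple_inj hij (a := k) (b := 0)
  rw [zpow_zero, one_mul] at this
  simp only [inversionParity_simple, this]

theorem inversionParity_simple_right (hij : ¬ Commute (cs.simple i) (cs.simple j)) (k : ℤ) :
    h.inversionParity (cs.simple j) ((cs.simple i * cs.simple j) ^ k * cs.simple i) =
      if k = -1 then 1 else 0 := by
  classical
  have := h.zpow_mul_simple_inj hij (a := k) (b := -1)
  rw [← simple_eq_zpow_neg_one_mul] at this
  simp only [inversionParity_simple, this]

theorem inversionParity_simple_mul_simple (hij : ¬ Commute (cs.simple i) (cs.simple j)) (k : ℤ) :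
    h.inversionParity (cs.simple i * cs.simple j)
      ((cs.simple i * cs.simple j) ^ k * cs.simple i) =
      (if k = -1 then 1 else 0) + if k = -2 then 1 else 0 := by
  have hconj : cs.simple j * ((cs.simple i * cs.simple j) ^ k * cs.simple i) * (cs.simple j)⁻¹ =
      (cs.simple i * cs.simple j) ^ (-k - 2) * cs.simple i := by
    have := cs.conj_zpow_mul_simple i j 1 k
    have hk : -k - 2 = -(k + 2 * 1) := by ring
    rw [hk, ← simple_mul_zpow, ← mul_left_inj (cs.simple i), mul_assoc (cs.simple i), ← this]
    simp [mul_assoc]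
  rw [inversionParity_mul, hconj, h.inversionParity_simple_left hij,
    h.inversionParity_simple_right hij]
  simp only [show -k - 2 = 0 ↔ k = -2 by omega]

theorem inversionParity_pow (hij : ¬ Commute (cs.simple i) (cs.simple j)) (m : ℕ) {k : ℤ}
    (hk : 0 ≤ k) :
    h.inversionParity ((cs.simple i * cs.simple j) ^ m)
      ((cs.simple i * cs.simple j) ^ k * cs.simple i) = 0 := by
  induction m with
  | zero => simp
  | succ m ih =>
    have := cs.conj_zpow_mul_simple i j m k
    rw [zpow_natCast] at this
    rw [pow_succ', inversionParity_mul, ih, this, h.inversionParity_simple_mul_simple hij,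
      if_neg (by omega), if_neg (by omega)]
    simp

theorem inversionParity_inv (w r : W) :
    h.inversionParity w⁻¹ r = h.inversionParity w (w⁻¹ * r * w) := by
  have := h.inversionParity_mul w w⁻¹ r
  rw [mul_inv_cancel, inversionParity_one, inv_inv] at this
  exact CharTwo.add_eq_zero.1 this.symm

theorem inversionParity_inv_pow (hij : ¬ Commute (cs.simple i) (cs.simple j)) (m : ℕ) {k : ℤ}
    (hk : k < 0) :
    h.inversionParity ((cs.simple i * cs.simple j) ^ (-m : ℤ))
      ((cs.simple i * cs.simple j) ^ k * cs.simple i) = 0 := by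
  induction m with
  | zero => simp
  | succ m ih =>
    have h1 : (-(m + 1 : ℕ) : ℤ) = -1 + -m := by push_cast; ring
    have h2 := cs.conj_zpow_mul_simple i j (-1) (k + 2 * -m)
    rw [zpow_neg_one, inv_inv] at h2
    rw [h1, zpow_add, inversionParity_mul, ih, conj_zpow_mul_simple, zpow_neg_one,
      inversionParity_inv, h2, h.inversionParity_simple_mul_simple hij,
      if_neg (by omega), if_neg (by omega)]
    simp

theorem inversionParity_eq_zero_of_mem_closure_pair
    (hij : ¬ Commute (cs.simple i) (cs.simple j)) {u : W}
    (hu : u ∈ Subgroup.closure {cs.simple i, cs.simple j}) :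
    h.inversionParity u (cs.simple i) = 0 ∨ h.inversionParity u (cs.simple j) = 0 := by
  have hi : cs.simple i = (cs.simple i * cs.simple j) ^ (0 : ℤ) * cs.simple i := by simp
  have hj := cs.simple_eq_zpow_neg_one_mul i j
  obtain ⟨m, hm⟩ := cs.exists_zpow_of_mem_closure_pair hu
  rcases lt_or_ge 0 m with hpos | hneg
  · left
    have hz := h.inversionParity_pow hij m.toNat le_rfl
    rw [← zpow_natCast, Int.toNat_of_nonneg hpos.le, ← hi] at hz
    rcases hm with rfl | rfl
    · exact hz
    · have := cs.conj_zpow_mul_simple i j m 0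
      rw [← hi] at this
      rw [inversionParity_mul, hz, this, h.inversionParity_simple_left hij, if_neg (by omega),
        zero_add]
  · right
    have hz := h.inversionParity_inv_pow hij (-m).toNat (k := -1) (by omega)
    rw [Int.toNat_of_nonneg (by omega), neg_neg, ← hj] at hz
    rcases hm with rfl | rfl
    · exact hz
    · have := cs.conj_zpow_mul_simple i j m (-1)
      rw [← hj] at this
      rw [inversionParity_mul, hz, this, h.inversionParity_simple_left hij, if_neg (by omega),
        zero_add]

include h in
theorem commute_of_isRightDescent {w : W} (hi : cs.IsRightDescent w i)
    (hj : cs.IsRightDescent w j) : Commute (cs.simple i) (cs.simple j) := by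
  by_contra hij
  set H := Subgroup.closure {cs.simple i, cs.simple j} with hH
  have hiH : cs.simple i ∈ H := Subgroup.subset_closure (by simp)
  have hjH : cs.simple j ∈ H := Subgroup.subset_closure (by simp)
  obtain ⟨u, hu, hmin⟩ := (measure fun u => cs.length (w * u)).wf.has_min (H : Set W)
    ⟨1, H.one_mem⟩
  have key : ∀ s ∈ H, h.inversionParity w s = h.inversionParity u⁻¹ s := by
    intro s hs
    have hw : w = w * u * u⁻¹ := by simp
    conv_lhs => rw [hw]
    rw [inversionParity_mul]
    by_contra hne
    have := h.length_mul_lt_of_inversionParity_ne_zero fun hz => hne (add_eq_left.2 hz)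
    refine hmin (s * u) (H.mul_mem hs hu) ?_
    change cs.length (w * (s * u)) < cs.length (w * u)
    simpa only [mul_assoc, inv_inv, mul_inv_cancel_left] using this
  rw [h.isRightDescent_iff_inversionParity] at hi hj
  rw [key _ hiH] at hi
  rw [key _ hjH] at hj
  exact (h.inversionParity_eq_zero_of_mem_closure_pair hij (H.inv_mem hu)).elim hi hj

end Dihedral

include h in
theorem finite_closure_simple_iff {T : Set B} (hT : T.Finite) :
    ((Subgroup.closure (cs.simple '' T) : Subgroup W) : Set W).Finite ↔
      ∀ i ∈ T, ∀ j ∈ T, Commute (cs.simple i) (cs.simple j) := by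
  constructor
  · intro hfin i hi j hj
    by_contra hij
    have := hfin.to_subtype
    have hmem : cs.simple i * cs.simple j ∈ Subgroup.closure (cs.simple '' T) :=
      mul_mem (Subgroup.subset_closure ⟨i, hi, rfl⟩) (Subgroup.subset_closure ⟨j, hj, rfl⟩)
    have hfo : IsOfFinOrder (⟨_, hmem⟩ : Subgroup.closure (cs.simple '' T)) :=
      isOfFinOrder_of_finite _
    exact orderOf_eq_zero_iff.1 (h.orderOf_eq_zero hij) (Submonoid.isOfFinOrder_coe.2 hfo)
  · intro hcomm
    induction T, hT using Set.Finite.induction_on with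
    | empty => simp
    | @insert a T _ _ ih =>
      have hT := ih fun i hi j hj => hcomm i (Or.inr hi) j (Or.inr hj)
      refine (hT.union (hT.image (cs.simple a * ·))).subset fun u hu => ?_
      have step : ∀ y ∈ cs.simple '' insert a T, ∀ u : W,
          u ∈ (Subgroup.closure (cs.simple '' T) : Set W) ∪
            (cs.simple a * ·) '' (Subgroup.closure (cs.simple '' T) : Set W) →
          y * u ∈ (Subgroup.closure (cs.simple '' T) : Set W) ∪
            (cs.simple a * ·) '' (Subgroup.closure (cs.simple '' T) : Set W) := by
        rintro _ ⟨b, rfl | hb, rfl⟩ u (hu | ⟨u, hu, rfl⟩)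
        · exact Or.inr ⟨u, hu, rfl⟩
        · exact Or.inl (by simpa using hu)
        · exact Or.inl (mul_mem (Subgroup.subset_closure ⟨b, hb, rfl⟩) hu)
        · refine Or.inr ⟨cs.simple b * u,
            mul_mem (Subgroup.subset_closure ⟨b, hb, rfl⟩) hu, ?_⟩
          simp only [← mul_assoc, (hcomm a (Or.inl rfl) b (Or.inr hb)).eq]
      induction hu using Subgroup.closure_induction_left with
      | one => exact Or.inl (one_mem _)
      | mul_left y hy u _ ih => exact step y hy u ih
      | inv_mul_cancel y hy u _ ih =>
        have : y⁻¹ = y := by obtain ⟨b, -, rfl⟩ := hy; simp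
        rw [this]
        exact step y hy u ih

end IsRightAngled

section Growth

theorem finite_length_eq [Finite B] (cs : CoxeterSystem M W) (m : ℕ) :
    {w : W | cs.length w = m}.Finite := by
  refine ((List.finite_length_eq B m).image cs.wordProd).subset fun w hw => ?_
  obtain ⟨ω, hω, rfl⟩ := cs.exists_isReduced w
  exact ⟨ω, hω.eq.symm.trans hw, rfl⟩

/-- The growth series of the set of elements having all elements of `T` as right descents. -/
noncomputable def descentGrowthSeries (cs : CoxeterSystem M W) (T : Finset B) : PowerSeries ℤ :=
  PowerSeries.mk fun m =>
    ({w : W | cs.length w = m ∧ ∀ i ∈ T, cs.IsRightDescent w i}.ncard : ℤ)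

theorem descentGrowthSeries_empty (cs : CoxeterSystem M W) :
    cs.descentGrowthSeries ∅ =
      PowerSeries.mk fun m => (Nat.card {w : W // cs.length w = m} : ℤ) := by
  simp only [descentGrowthSeries, Finset.notMem_empty, false_implies, implies_true, and_true]
  rfl

open PowerSeries in
theorem IsRightAngled.one_add_X_mul_descentGrowthSeries_insert [Finite B] [DecidableEq B]
    (h : cs.IsRightAngled) {T : Finset B} {a : B} (ha : a ∉ T)
    (hcomm : ∀ i ∈ T, Commute (cs.simple i) (cs.simple a)) :
    (1 + X) * cs.descentGrowthSeries (insert a T) = X * cs.descentGrowthSeries T := by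
  have hdesc : ∀ w : W, ∀ i ∈ T,
      (cs.IsRightDescent (w * cs.simple a) i ↔ cs.IsRightDescent w i) := fun w i hi =>
    h.isRightDescent_mul_simple_iff (by rintro rfl; exact ha hi) (hcomm i hi) w
  ext m
  rw [add_mul, one_mul, map_add]
  cases m with
  | zero =>
    have : {w : W | cs.length w = 0 ∧ ∀ i ∈ insert a T, cs.IsRightDescent w i} = ∅ := by
      ext w
      simp only [Set.mem_ofPred_eq, Set.mem_empty_iff_false, iff_false, not_and, length_eq_zero_iff]
      rintro rfl hw
      exact cs.not_isRightDescent_one a (hw a (Finset.mem_insert_self a T))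
    rw [coeff_zero_X_mul, coeff_zero_X_mul, descentGrowthSeries, coeff_mk, this]
    simp
  | succ m =>
    rw [coeff_succ_X_mul, coeff_succ_X_mul]
    simp only [descentGrowthSeries, coeff_mk]
    have hfin : {w : W | cs.length w = m ∧ ∀ i ∈ T, cs.IsRightDescent w i}.Finite :=
      (cs.finite_length_eq m).subset fun w hw => hw.1
    have hsplit := Set.ncard_inter_add_ncard_sdiff_eq_ncard
      {w : W | cs.length w = m ∧ ∀ i ∈ T, cs.IsRightDescent w i}
      {w : W | cs.IsRightDescent w a} hfin
    have hinter : {w : W | cs.length w = m ∧ ∀ i ∈ T, cs.IsRightDescent w i} ∩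
        {w : W | cs.IsRightDescent w a} =
        {w : W | cs.length w = m ∧ ∀ i ∈ insert a T, cs.IsRightDescent w i} := by
      ext w
      simp only [Set.mem_inter_iff, Set.mem_ofPred_eq, Finset.forall_mem_insert]
      tauto
    have hdiff : (· * cs.simple a) '' ({w : W | cs.length w = m ∧ ∀ i ∈ T,
        cs.IsRightDescent w i} \ {w : W | cs.IsRightDescent w a}) =
        {w : W | cs.length w = m + 1 ∧ ∀ i ∈ insert a T, cs.IsRightDescent w i} := by
      ext w
      simp only [Set.mem_image, Set.mem_sdiff, Set.mem_ofPred_eq, Finset.forall_mem_insert]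
      constructor
      · rintro ⟨v, ⟨⟨hl, hv⟩, hva⟩, rfl⟩
        refine ⟨by rw [cs.not_isRightDescent_iff.1 hva, hl], ?_,
          fun i hi => (hdesc v i hi).2 (hv i hi)⟩
        rw [isRightDescent_iff_not_isRightDescent_mul, simple_mul_simple_cancel_right]
        exact hva
      · rintro ⟨hl, hwa, hw⟩
        refine ⟨w * cs.simple a, ⟨⟨?_, fun i hi => (hdesc w i hi).2 (hw i hi)⟩, ?_⟩, by simp⟩
        · have := cs.isRightDescent_iff.1 hwa
          omega
        · exact cs.isRightDescent_iff_not_isRightDescent_mul.1 hwa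
    rw [← hdiff, Set.ncard_image_of_injective _ (mul_left_injective (cs.simple a)), ← hsplit,
      hinter]
    push_cast
    ring

open PowerSeries in
theorem IsRightAngled.one_add_X_pow_mul_descentGrowthSeries [Finite B] (h : cs.IsRightAngled)
    {T : Finset B} (hcomm : ∀ i ∈ T, ∀ j ∈ T, Commute (cs.simple i) (cs.simple j)) :
    (1 + X) ^ T.card * cs.descentGrowthSeries T = X ^ T.card * cs.descentGrowthSeries ∅ := by
  classical
  induction T using Finset.induction_on with
  | empty => simp
  | insert a T ha ih =>
    have ih := ih fun i hi j hj =>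
      hcomm i (Finset.mem_insert_of_mem hi) j (Finset.mem_insert_of_mem hj)
    rw [Finset.card_insert_of_notMem ha, pow_succ, mul_assoc,
      h.one_add_X_mul_descentGrowthSeries_insert ha fun i hi =>
        hcomm i (Finset.mem_insert_of_mem hi) a (Finset.mem_insert_self a T),
      mul_left_comm, ih]
    ring

open scoped Classical in
/-- The alternating sum of the descent growth series over any family of subsets containing every
subset of a descent set collapses to `1`. -/
theorem sum_neg_one_pow_mul_descentGrowthSeries [Fintype B] (cs : CoxeterSystem M W)
    (p : Finset B → Prop) (hp : ∀ (w : W) (T : Finset B),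
      (∀ i ∈ T, cs.IsRightDescent w i) → p T) :
    ∑ T ∈ Finset.univ.filter p, (-1) ^ T.card * cs.descentGrowthSeries T = 1 := by
  ext m
  set F := (cs.finite_length_eq m).toFinset with hF
  have hcard : ∀ T : Finset B,
      {w : W | cs.length w = m ∧ ∀ i ∈ T, cs.IsRightDescent w i}.ncard =
        (F.filter fun w => ∀ i ∈ T, cs.IsRightDescent w i).card := by
    intro T
    rw [← Set.ncard_coe_finset]
    congr 1
    ext w
    simp [hF]
  have hcoeff : ∀ T : Finset B,
      PowerSeries.coeff m ((-1) ^ T.card * cs.descentGrowthSeries T) =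
        ∑ w ∈ F, if ∀ i ∈ T, cs.IsRightDescent w i then (-1 : ℤ) ^ T.card else 0 := by
    intro T
    have : ((-1) ^ T.card : PowerSeries ℤ) = PowerSeries.C ((-1) ^ T.card) := by simp
    rw [this, PowerSeries.coeff_C_mul, descentGrowthSeries, PowerSeries.coeff_mk, hcard,
      ← Finset.sum_filter, Finset.sum_const, nsmul_eq_mul, mul_comm]
  have hinner : ∀ w : W, (∑ T ∈ Finset.univ.filter p,
      if ∀ i ∈ T, cs.IsRightDescent w i then (-1 : ℤ) ^ T.card else 0) =
        if w = 1 then 1 else 0 := by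
    intro w
    have hset : (Finset.univ.filter p).filter (fun T => ∀ i ∈ T, cs.IsRightDescent w i) =
        (Finset.univ.filter fun i => cs.IsRightDescent w i).powerset := by
      ext T
      simp only [Finset.mem_filter, Finset.mem_univ, true_and, Finset.mem_powerset,
        Finset.subset_iff]
      exact ⟨fun hT => hT.2, fun hT => ⟨hp w T hT, hT⟩⟩
    rw [← Finset.sum_filter, hset, Finset.sum_powerset_neg_one_pow_card]
    congr 1
    rw [Finset.filter_eq_empty_iff, eq_iff_iff]
    constructor
    · intro hw
      by_contra hne
      obtain ⟨i, hi⟩ := cs.exists_rightDescent_of_ne_one hne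
      exact hw (Finset.mem_univ i) hi
    · rintro rfl i -
      exact cs.not_isRightDescent_one i
  rw [map_sum, Finset.sum_congr rfl fun T _ => hcoeff T, Finset.sum_comm,
    Finset.sum_congr rfl fun w _ => hinner w, Finset.sum_ite_eq', PowerSeries.coeff_one]
  simp [hF, eq_comm]

end Growth

end CoxeterSystem

open scoped Classical in
/-- **`1/W(t) = h_L(−t)/(1+t)ⁿ` for right-angled Coxeter systems.**
Let `(W, S)` be a right-angled Coxeter system with `S` finite (for distinct `s, s' ∈ S` the
order of `ss'` is `2` or `∞`), let `𝒮` be the set of spherical subsets of `S` and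
`n = max {Card T : T ∈ 𝒮}` (so the nerve `L` has dimension `n − 1`).  Then in `ℤ⟦t⟧`:
`(Σ_{w ∈ W} t^{ℓ w}) · (Σ_{T ∈ 𝒮} (−t)^{Card T} (1+t)^{n − Card T}) = (1+t)ⁿ`;
equivalently, `1/W(t) = h_L(−t)/(1+t)ⁿ` where `h_L` is the h-polynomial of the nerve. -/
theorem rightangled_growth_h_polynomial {B : Type*} [Fintype B] {W : Type*} [Group W]
    {M : CoxeterMatrix B} (cs : CoxeterSystem M W)
    (hra : ∀ i j : B, i ≠ j →
      orderOf (cs.simple i * cs.simple j) = 2 ∨ orderOf (cs.simple i * cs.simple j) = 0)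
    (n : ℕ)
    (hn : IsGreatest {k : ℕ | ∃ T : Finset B,
      ((Subgroup.closure (cs.simple '' ↑T) : Subgroup W) : Set W).Finite ∧ T.card = k} n) :
    PowerSeries.mk (fun m => (Nat.card {w : W // cs.length w = m} : ℤ)) *
        (∑ T ∈ Finset.univ.filter (fun T : Finset B =>
            ((Subgroup.closure (cs.simple '' ↑T) : Subgroup W) : Set W).Finite),
          (-PowerSeries.X : PowerSeries ℤ) ^ T.card *
            (1 + PowerSeries.X) ^ (n - T.card)) =
      (1 + PowerSeries.X) ^ n := by
  have h : cs.IsRightAngled := hra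
  have hspherical := fun T : Finset B => h.finite_closure_simple_iff T.finite_toSet
  rw [← cs.descentGrowthSeries_empty, Finset.mul_sum]
  have hterm : ∀ T ∈ Finset.univ.filter (fun T : Finset B =>
      ((Subgroup.closure (cs.simple '' ↑T) : Subgroup W) : Set W).Finite),
      cs.descentGrowthSeries ∅ * ((-PowerSeries.X : PowerSeries ℤ) ^ T.card *
        (1 + PowerSeries.X) ^ (n - T.card)) =
      (1 + PowerSeries.X) ^ n * ((-1) ^ T.card * cs.descentGrowthSeries T) := by
    intro T hT
    have hT := (Finset.mem_filter.1 hT).2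
    have hle : T.card ≤ n := hn.2 ⟨T, hT, rfl⟩
    have hgrowth := h.one_add_X_pow_mul_descentGrowthSeries ((hspherical T).1 hT)
    rw [neg_pow, ← Nat.sub_add_cancel hle, pow_add, Nat.add_sub_cancel]
    linear_combination (-(1 + PowerSeries.X) ^ (n - T.card) * (-1) ^ T.card) * hgrowth
  rw [Finset.sum_congr rfl hterm, ← Finset.mul_sum,
    cs.sum_neg_one_pow_mul_descentGrowthSeries _ fun w T hT => (hspherical T).2 fun i hi j hj =>
      h.commute_of_isRightDescent (hT i hi) (hT j hj), mul_one]
end
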